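/- arXiv:2205.07932 — 2 statements merged into one kernel-verified Lean document; each statement's English description precedes it below -/
import Mathlib

section
/- Let V be an n×(p·d) random real matrix uniformly distributed on the Stiefel manifold V(n, p·d), with columns partitioned into p consecutive blocks of d columns. Let A ⊆ {1,…,p} with |A| = a, and let K ⊆ {1,…,p} \ A be a set of q block indices. Suppose (p − a − 1)·d ≥ n. Then for any t₈, t₉, t₁₀ > 0 with √((a+1)d/n) + t₈ < 1, √((a+1)/p) + t₉ < 1, √((a+1)/p) + t₁₀ < 1/3, one has P[ max_{k∈K} ‖(p d/n)·V_Aᵀ V_k‖ ≥ (3(√((a+1)d/n) + t₈) + 3(√((a+1)/p) + t₉)) / (1 − 3(√((a+1)/p) + t₁₀)) ] ≤ q·(2·exp(−n t₈²/2) + 2·exp(−p d t₉²/2) + exp(−p d t₁₀²/2)). -/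
open MeasureTheory ProbabilityTheory Filter Matrix
open scoped ENNReal NNReal

noncomputable section

/-- Euclidean norm of a finite real vector. -/
def euclNorm {ι : Type*} [Fintype ι] (v : ι → ℝ) : ℝ := Real.sqrt (∑ i, v i ^ 2)

/-- Spectral norm (largest singular value) of a real matrix. -/
def specNorm {m n : Type*} [Fintype m] [Fintype n] [DecidableEq n] (A : Matrix m n ℝ) : ℝ :=
  ‖LinearMap.toContinuousLinearMap (Matrix.toEuclideanLin A)‖

instance {m n α : Type*} [MeasurableSpace α] : MeasurableSpace (Matrix m n α) :=
  inferInstanceAs (MeasurableSpace (m → n → α))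

/-- `V` is uniformly distributed on the Stiefel manifold `V(n, ι)`:
`V Vᵀ = I_n` almost surely and `V·O` has the same distribution as `V` for every
fixed orthogonal matrix `O`. -/
def IsUniformStiefel {Ω ι : Type*} [MeasurableSpace Ω] [Fintype ι] [DecidableEq ι]
    (P : Measure Ω) {n : ℕ} (V : Ω → Matrix (Fin n) ι ℝ) : Prop :=
  Measurable V ∧ (∀ᵐ ω ∂P, V ω * (V ω)ᵀ = 1) ∧
    ∀ O : Matrix ι ι ℝ, O * Oᵀ = 1 →
      Measure.map (fun ω => V ω * O) P = Measure.map V P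

/-- The submatrix of a block matrix `V` consisting of the column blocks indexed by `J`. -/
def blockCols {n p d : ℕ} (V : Matrix (Fin n) (Fin p × Fin d) ℝ) (J : Finset (Fin p)) :
    Matrix (Fin n) ({j // j ∈ J} × Fin d) ℝ :=
  fun i jk => V i (jk.1.1, jk.2)

/-- The `k`-th column block of a block matrix `V`. -/
def colBlock {n p d : ℕ} (V : Matrix (Fin n) (Fin p × Fin d) ℝ) (k : Fin p) :
    Matrix (Fin n) (Fin d) ℝ :=
  fun i l => V i (k, l)

section gauss
variable {E : Type*} [NormedAddCommGroup E] [InnerProductSpace ℝ E] [FiniteDimensional ℝ E]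
  [MeasurableSpace E] [BorelSpace E]

lemma stdGaussian_eq_withDensity :
    stdGaussian E = (volume : Measure E).withDensity (fun x => ENNReal.ofReal
      ((2 * Real.pi) ^ (-(Module.finrank ℝ E : ℝ) / 2) * Real.exp (-‖x‖ ^ 2 / 2))) := by
  have hint : Integrable (fun x : E =>
      (2 * Real.pi) ^ (-(Module.finrank ℝ E : ℝ) / 2) * Real.exp (-‖x‖ ^ 2 / 2)) := by
    apply Integrable.const_mul
    have := GaussianFourier.integrable_cexp_neg_mul_sq_norm_add (V := E) (b := 1/2) (by norm_num) 0 0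
    have := this.re
    refine this.congr (ae_of_all _ fun x => ?_)
    simp only [zero_mul, add_zero]
    have : (-(1 / 2 : ℂ) * (‖x‖ : ℂ) ^ 2) = ((-‖x‖^2/2 : ℝ) : ℂ) := by push_cast; ring
    rw [this, ← Complex.ofReal_exp]
    exact Complex.ofReal_re _
  have : IsFiniteMeasure ((volume : Measure E).withDensity (fun x => ENNReal.ofReal
      ((2 * Real.pi) ^ (-(Module.finrank ℝ E : ℝ) / 2) * Real.exp (-‖x‖ ^ 2 / 2)))) :=
    isFiniteMeasure_withDensity_ofReal hint.2
  apply Measure.ext_of_charFun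
  ext t
  rw [charFun_stdGaussian, charFun_apply, integral_withDensity_eq_integral_toReal_smul (by fun_prop) (by simp)]
  have h1 : ∀ x : E, (ENNReal.ofReal
      ((2 * Real.pi) ^ (-(Module.finrank ℝ E : ℝ) / 2) * Real.exp (-‖x‖ ^ 2 / 2))).toReal •
      Complex.exp (inner ℝ x t * Complex.I) = (((2 * Real.pi) ^ (-(Module.finrank ℝ E : ℝ) / 2) : ℝ) : ℂ) * Complex.exp (-(1/2 : ℂ) * ‖x‖ ^ 2 + Complex.I * inner ℝ t x) := by
    intro x
    rw [ENNReal.toReal_ofReal (by positivity), Complex.real_smul, Complex.ofReal_mul, mul_assoc,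
      Complex.ofReal_exp, ← Complex.exp_add, real_inner_comm]
    congr 2
    push_cast
    ring
  simp_rw [h1]
  rw [integral_const_mul, GaussianFourier.integral_cexp_neg_mul_sq_norm_add (by norm_num)]
  rw [← mul_assoc]
  have h2 : (((2 * Real.pi) ^ (-(Module.finrank ℝ E : ℝ) / 2) : ℝ) : ℂ) * ((Real.pi : ℂ) / (1 / 2)) ^ ((Module.finrank ℝ E : ℂ) / 2) = 1 := by
    have : ((Real.pi : ℂ) / (1 / 2)) = ((2 * Real.pi : ℝ) : ℂ) := by push_cast; ring
    rw [this, show ((Module.finrank ℝ E : ℂ) / 2) = (((Module.finrank ℝ E : ℝ) / 2 : ℝ) : ℂ) by push_cast; rfl,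
      ← Complex.ofReal_cpow (by positivity), ← Complex.ofReal_mul, ← Real.rpow_add (by positivity)]
    simp [neg_div]
  rw [h2, one_mul]
  congr 1
  simp
  ring

def risF (j : ℕ) (r : ℕ) : ℝ := ∏ i ∈ Finset.range j, ((r : ℝ) + 2 * i)

lemma gauss_moment_pos [Nontrivial E] (j : ℕ) :
    ∫ x : E, ‖x‖ ^ (2 * j) ∂(stdGaussian E) = risF j (Module.finrank ℝ E) := by
  set r := Module.finrank ℝ E with hr
  have hr1 : 1 ≤ r := Module.finrank_pos
  have key : ∀ j : ℕ, ∫ x : E, ‖x‖ ^ (2 * j) ∂(stdGaussian E) =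
     ((2 * Real.pi) ^ (-(r : ℝ) / 2) * (r * (volume : Measure E).real (Metric.ball 0 1))) *
       ((1 / 2 : ℝ) ^ (-((r : ℝ) + 2 * j) / 2) * (1 / 2) * Real.Gamma (((r : ℝ) + 2 * j) / 2)) := by
    intro j
    rw [stdGaussian_eq_withDensity, integral_withDensity_eq_integral_toReal_smul (by fun_prop) (by simp)]
    have h1 : ∀ x : E, (ENNReal.ofReal
      ((2 * Real.pi) ^ (-(r : ℝ) / 2) * Real.exp (-‖x‖ ^ 2 / 2))).toReal • ‖x‖ ^ (2 * j) = 
      (2 * Real.pi) ^ (-(r : ℝ) / 2) * ((fun y : ℝ => Real.exp (-y ^ 2 / 2) * y ^ (2 * j)) ‖x‖) := by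
      intro x
      rw [ENNReal.toReal_ofReal (by positivity), smul_eq_mul, mul_assoc]
    simp_rw [← hr, h1]
    rw [integral_const_mul, integral_fun_norm_addHaar (volume : Measure E) (fun y : ℝ => Real.exp (-y ^ 2 / 2) * y ^ (2 * j)), ← hr, nsmul_eq_mul, smul_eq_mul, mul_assoc, mul_assoc]
    congr 3
    rw [show -((r : ℝ) + 2 * j) / 2 = -(((r : ℝ) - 1 + 2 * j) + 1) / 2 by ring, 
      show ((r : ℝ) + 2 * j) / 2 = (((r : ℝ) - 1 + 2 * j) + 1) / 2 by ring,
      ← integral_rpow_mul_exp_neg_mul_rpow (p := 2) (by norm_num) (by 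
        have : (1 : ℝ) ≤ r := by exact_mod_cast hr1
        have : (0 : ℝ) ≤ j := by positivity
        linarith) (by norm_num)]
    refine setIntegral_congr_fun measurableSet_Ioi fun y hy => ?_
    have hy' : (0 : ℝ) < y := hy
    simp only [smul_eq_mul]
    rw [show ((r : ℝ) - 1 + 2 * j) = ((r - 1 + 2 * j : ℕ) : ℝ) by push_cast [hr1]; ring, Real.rpow_natCast, pow_add, 
      show (2 : ℝ) = ((2 : ℕ) : ℝ) by norm_num, Real.rpow_natCast]
    rw [show -y ^ 2 / ((2 : ℕ) : ℝ) = -(1 / ((2 : ℕ) : ℝ)) * y ^ 2 by ring]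
    ring
  induction j with
  | zero => simp [risF]
  | succ j ih =>
    rw [risF, Finset.prod_range_succ, ← risF, ← ih, key, key]
    have : ((r : ℝ) + 2 * ((j + 1 : ℕ) : ℝ)) / 2 = ((r : ℝ) + 2 * j) / 2 + 1 := by push_cast; ring
    rw [this, Real.Gamma_add_one (by positivity)]
    rw [show -((r : ℝ) + 2 * ((j + 1 : ℕ) : ℝ)) / 2 = -((r : ℝ) + 2 * j) / 2 - 1 by push_cast; ring, Real.rpow_sub_one (by norm_num)]
    ring

lemma gauss_R (j : ℕ) :
    ∫⁻ x : E, ‖x‖ₑ ^ (2 * j) ∂(stdGaussian E) = ENNReal.ofReal (risF j (Module.finrank ℝ E)) := by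
  rcases subsingleton_or_nontrivial E with h | h
  · have h0 : ∀ x : E, x = 0 := fun x => Subsingleton.elim _ _
    rw [Module.finrank_zero_of_subsingleton]
    rcases j with _ | j
    · simp [risF]
    · simp [h0, risF, Finset.prod_range_succ']
  · rw [← gauss_moment_pos, ofReal_integral_eq_lintegral_ofReal]
    · refine lintegral_congr fun x => ?_
      rw [ENNReal.ofReal_pow (norm_nonneg _), ofReal_norm]
    · apply Integrable.of_integral_ne_zero
      rw [gauss_moment_pos]
      have : 0 < Module.finrank ℝ E := Module.finrank_pos
      unfold risF
      positivity
    · exact ae_of_all _ fun x => by positivity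

lemma gauss_lin (j : ℕ) (y : E) :
    ∫⁻ x : E, ‖inner ℝ x y‖ₑ ^ (2 * j) ∂(stdGaussian E) = ENNReal.ofReal (risF j 1) * ‖y‖ₑ ^ (2 * j) := by
  have hm : (stdGaussian E).map (fun x => inner ℝ x y) = (stdGaussian ℝ).map (fun x => ‖y‖ * x) := by
    apply Measure.ext_of_charFun
    ext t
    rw [charFun_apply, integral_map (by fun_prop) (by fun_prop), charFun_apply, integral_map (by fun_prop) (by fun_prop)]
    have h1 := charFun_stdGaussian (E := E) (t • y)
    have h2 := charFun_stdGaussian (E := ℝ) (‖y‖ * t)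
    rw [charFun_apply] at h1 h2
    have e1 : ∀ x : E, inner ℝ (inner ℝ x y) t = inner ℝ x (t • y) := by
      intro x; rw [inner_smul_right]; simp
    have e2 : ∀ x : ℝ, inner ℝ (‖y‖ * x) t = inner ℝ x (‖y‖ * t) := by
      intro x; simp; ring
    simp_rw [e1, e2]
    rw [h1, h2]
    simp [norm_smul, mul_comm]
  have := congrArg (fun μ => ∫⁻ x : ℝ, ‖x‖ₑ ^ (2 * j) ∂μ) hm
  rw [lintegral_map (by fun_prop) (by fun_prop), lintegral_map (by fun_prop) (by fun_prop)] at this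
  rw [this]
  simp_rw [enorm_mul, mul_pow]
  rw [lintegral_const_mul _ (by fun_prop), gauss_R, Module.finrank_self, enorm_norm, mul_comm]

end gauss

section stief
variable {ι : Type*} [Fintype ι] [DecidableEq ι]

lemma inner_toEuclideanLin {κ : Type*} [Fintype κ] [DecidableEq κ] (V : Matrix κ ι ℝ)
    (y : EuclideanSpace ℝ ι) (x : EuclideanSpace ℝ κ) :
    inner ℝ (toEuclideanLin V y) x = inner ℝ y (toEuclideanLin Vᵀ x) := by
  have := Matrix.toEuclideanLin_conjTranspose_eq_adjoint V
  rw [Matrix.conjTranspose_eq_transpose_of_trivial] at this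
  rw [this, LinearMap.adjoint_inner_right]

lemma norm_transpose {κ : Type*} [Fintype κ] [DecidableEq κ] (V : Matrix κ ι ℝ)
    (hV : V * Vᵀ = 1) (x : EuclideanSpace ℝ κ) : ‖toEuclideanLin Vᵀ x‖ = ‖x‖ := by
  have h : inner ℝ (toEuclideanLin Vᵀ x) (toEuclideanLin Vᵀ x) = inner ℝ x x := by
    rw [← inner_toEuclideanLin]
    congr 1
    ext i
    simp [Matrix.toEuclideanLin, Matrix.mulVec_mulVec, hV]
  rw [real_inner_self_eq_norm_sq, real_inner_self_eq_norm_sq] at h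
  exact (sq_eq_sq₀ (norm_nonneg _) (norm_nonneg _)).1 h

lemma exists_orth (y z : EuclideanSpace ℝ ι) (h : ‖y‖ = ‖z‖) :
    ∃ O : Matrix ι ι ℝ, O * Oᵀ = 1 ∧ toEuclideanLin O y = z ∧
      ∀ e : EuclideanSpace ℝ ι, inner ℝ e (y - z) = 0 → toEuclideanLin O e = e := by
  let T : EuclideanSpace ℝ ι ≃ₗᵢ[ℝ] EuclideanSpace ℝ ι := (Submodule.span ℝ {y - z})ᗮ.reflection
  let O : Matrix ι ι ℝ := toEuclideanLin.symm T.toLinearEquiv.toLinearMap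
  have hO : ∀ e, toEuclideanLin O e = T e := by
    intro e
    simp [O]
  refine ⟨O, ?_, ?_, ?_⟩
  · rw [mul_eq_one_comm]
    apply toEuclideanLin.injective
    ext e : 1
    have hadj := Matrix.toEuclideanLin_conjTranspose_eq_adjoint O
    rw [Matrix.conjTranspose_eq_transpose_of_trivial] at hadj
    refine ext_inner_left ℝ fun w => ?_
    have h1 : toEuclideanLin (Oᵀ * O) e = toEuclideanLin Oᵀ (toEuclideanLin O e) := by
      ext i
      simp [Matrix.toEuclideanLin, Matrix.mulVec_mulVec]
    have h2 : toEuclideanLin (1 : Matrix ι ι ℝ) e = e := by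
      ext i
      simp [Matrix.toEuclideanLin]
    rw [h1, h2, hadj, LinearMap.adjoint_inner_right, hO, hO, T.inner_map_map]
  · rw [hO]
    exact Submodule.reflection_sub h
  · intro e he
    rw [hO]
    apply Submodule.reflection_mem_subspace_eq_self
    rw [Submodule.mem_orthogonal_singleton_iff_inner_left]
    exact he

variable {Ω : Type*} [MeasurableSpace Ω] {P : Measure Ω} {n : ℕ}
  {V : Ω → Matrix (Fin n) ι ℝ}

lemma measurable_toEuc {κ : Type*} [Fintype κ] :
    Measurable (fun q : Matrix κ ι ℝ × EuclideanSpace ℝ ι => toEuclideanLin q.1 q.2) := by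
  have : (fun q : Matrix κ ι ℝ × EuclideanSpace ℝ ι => toEuclideanLin q.1 q.2) =
    fun q => WithLp.toLp 2 (fun i => ∑ l, q.1 i l * q.2 l) := by
    ext q i
    simp [Matrix.toEuclideanLin, Matrix.mulVec, dotProduct]
  rw [this]
  apply (WithLp.measurable_toLp 2 _).comp
  refine measurable_pi_lambda _ fun i => ?_
  refine Finset.measurable_fun_sum _ fun l _ => ?_
  refine Measurable.mul ?_ (by fun_prop)
  exact (measurable_pi_apply l).comp ((measurable_pi_apply i).comp measurable_fst)

lemma measurable_toEuc' {κ : Type*} [Fintype κ] {α : Type*} [MeasurableSpace α]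
    {f : α → Matrix κ ι ℝ} {g : α → EuclideanSpace ℝ ι} (hf : Measurable f) (hg : Measurable g) :
    Measurable (fun q => toEuclideanLin (f q) (g q)) := by
  have h := Measurable.comp (measurable_toEuc (κ := κ) (ι := ι)) (Measurable.prodMk hf hg)
  exact h

lemma measurable_mulO (O : Matrix ι ι ℝ) {f : Ω → Matrix (Fin n) ι ℝ} (hf : Measurable f) :
    Measurable (fun q => f q * O) := by
  refine measurable_pi_lambda _ fun i => measurable_pi_lambda _ fun l => ?_
  simp only [Matrix.mul_apply]
  refine Finset.measurable_fun_sum _ fun k _ => ?_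
  exact ((measurable_pi_apply k).comp ((measurable_pi_apply i).comp hf)).mul_const _

lemma inv_lintegral (hV : IsUniformStiefel P V) (O : Matrix ι ι ℝ) (hO : O * Oᵀ = 1)
    (f : Matrix (Fin n) ι ℝ → ℝ≥0∞) (hf : Measurable f) :
    ∫⁻ ω, f (V ω * O) ∂P = ∫⁻ ω, f (V ω) ∂P := by
  have := congrArg (fun μ => ∫⁻ x, f x ∂μ) (hV.2.2 O hO)
  rwa [lintegral_map hf (measurable_mulO O hV.1), lintegral_map hf hV.1] at this

lemma toEuc_mul {κ η : Type*} [Fintype κ] [Fintype η] [DecidableEq η] (A : Matrix κ ι ℝ)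
    (O : Matrix ι η ℝ) (e : EuclideanSpace ℝ η) :
    toEuclideanLin (A * O) e = toEuclideanLin A (toEuclideanLin O e) := by
  ext i
  simp [Matrix.toEuclideanLin, Matrix.mulVec_mulVec]

/-- mixed moment -/
def mixF (P : Measure Ω) (V : Ω → Matrix (Fin n) ι ℝ) (j : ℕ) (y e : EuclideanSpace ℝ ι) : ℝ≥0∞ :=
  ∫⁻ ω, ‖inner ℝ (toEuclideanLin (V ω) y) (toEuclideanLin (V ω) e)‖ₑ ^ (2 * j) ∂P

lemma mixF_congr (hV : IsUniformStiefel P V) (j : ℕ) (y z e : EuclideanSpace ℝ ι)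
    (h : ‖y‖ = ‖z‖) (hy : inner ℝ e y = 0) (hz : inner ℝ e z = 0) :
    mixF P V j y e = mixF P V j z e := by
  obtain ⟨O, hO, h1, h2⟩ := exists_orth y z h
  have h3 := h2 e (by rw [inner_sub_right, hy, hz, sub_zero])
  have := inv_lintegral hV O hO (fun W => ‖inner ℝ (toEuclideanLin W y) (toEuclideanLin W e)‖ₑ ^ (2 * j)) (by
    have a1 := measurable_toEuc' (κ := Fin n) (ι := ι) measurable_id (measurable_const (a := y))
    have a2 := measurable_toEuc' (κ := Fin n) (ι := ι) measurable_id (measurable_const (a := e))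
    exact ((a1.inner a2).enorm).pow_const _)
  simp only [toEuc_mul, h1, h3] at this
  exact this.symm

lemma mixF_smul (j : ℕ) (c : ℝ) (y e : EuclideanSpace ℝ ι) :
    mixF P V j (c • y) e = ‖c‖ₑ ^ (2 * j) * mixF P V j y e := by
  unfold mixF
  simp only [map_smul, inner_smul_left, enorm_mul, mul_pow]
  rw [lintegral_const_mul' _ _ (by simp)]
  simp

lemma mixF_homog (hV : IsUniformStiefel P V) (j : ℕ) (y z e : EuclideanSpace ℝ ι)
    (hy : inner ℝ e y = 0) (hz : inner ℝ e z = 0) :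
    ‖z‖ₑ ^ (2 * j) * mixF P V j y e = ‖y‖ₑ ^ (2 * j) * mixF P V j z e := by
  have := mixF_congr hV j (‖z‖ • y) (‖y‖ • z) e (by simp [norm_smul, mul_comm])
    (by rw [inner_smul_right, hy, mul_zero]) (by rw [inner_smul_right, hz, mul_zero])
  rwa [mixF_smul, mixF_smul, enorm_norm, enorm_norm] at this

def linF (P : Measure Ω) (V : Ω → Matrix (Fin n) ι ℝ) (j : ℕ) (e : EuclideanSpace ℝ ι)
    (x : EuclideanSpace ℝ (Fin n)) : ℝ≥0∞ :=
  ∫⁻ ω, ‖inner ℝ (toEuclideanLin (V ω) e) x‖ₑ ^ (2 * j) ∂P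

lemma linF_congr (hV : IsUniformStiefel P V) (j : ℕ) (y z : EuclideanSpace ℝ ι)
    (x : EuclideanSpace ℝ (Fin n)) (h : ‖y‖ = ‖z‖) :
    linF P V j y x = linF P V j z x := by
  obtain ⟨O, hO, h1, h2⟩ := exists_orth y z h
  have := inv_lintegral hV O hO (fun W => ‖inner ℝ (toEuclideanLin W y) x‖ₑ ^ (2 * j)) (by
    have a1 := measurable_toEuc' (κ := Fin n) (ι := ι) measurable_id (measurable_const (a := y))
    exact ((a1.inner_const).enorm).pow_const _)
  simp only [toEuc_mul, h1] at this
  exact this.symm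

lemma linF_smul (j : ℕ) (c : ℝ) (e : EuclideanSpace ℝ ι) (x : EuclideanSpace ℝ (Fin n)) :
    linF P V j (c • e) x = ‖c‖ₑ ^ (2 * j) * linF P V j e x := by
  unfold linF
  simp only [map_smul, inner_smul_left, enorm_mul, mul_pow]
  rw [lintegral_const_mul' _ _ (by simp)]
  simp

lemma linF_homog (hV : IsUniformStiefel P V) (j : ℕ) (y z : EuclideanSpace ℝ ι)
    (x : EuclideanSpace ℝ (Fin n)) :
    ‖z‖ₑ ^ (2 * j) * linF P V j y x = ‖y‖ₑ ^ (2 * j) * linF P V j z x := by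
  have := linF_congr hV j (‖z‖ • y) (‖y‖ • z) x (by simp [norm_smul, mul_comm])
  rwa [linF_smul, linF_smul, enorm_norm, enorm_norm] at this

lemma risF_one_ne (j : ℕ) : ENNReal.ofReal (risF j 1) ≠ 0 := by
  have : 0 < risF j 1 := by unfold risF; positivity
  simpa using this

lemma lemB [IsProbabilityMeasure P] (hV : IsUniformStiefel P V) (j : ℕ) (e : EuclideanSpace ℝ ι) :
    ENNReal.ofReal (risF j (Fintype.card ι)) * ∫⁻ ω, ‖toEuclideanLin (V ω) e‖ₑ ^ (2 * j) ∂P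
      = ‖e‖ₑ ^ (2 * j) * ENNReal.ofReal (risF j n) := by
  have h1 : ∀ x, ENNReal.ofReal (risF j (Fintype.card ι)) * linF P V j e x =
      ‖e‖ₑ ^ (2 * j) * (ENNReal.ofReal (risF j 1) * ‖x‖ₑ ^ (2 * j)) := by
    intro x
    have hR := gauss_R (E := EuclideanSpace ℝ ι) j
    rw [finrank_euclideanSpace] at hR
    rw [← hR, ← lintegral_mul_const _ (by fun_prop)]
    simp_rw [linF_homog hV j e _ x]
    rw [lintegral_const_mul' _ _ (by simp)]
    congr 1
    unfold linF
    have hm : Measurable (fun q : EuclideanSpace ℝ ι × Ω =>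
        ‖inner ℝ (toEuclideanLin (V q.2) q.1) x‖ₑ ^ (2 * j)) :=
      (((measurable_toEuc' (hV.1.comp measurable_snd) measurable_fst).inner_const).enorm).pow_const _
    rw [lintegral_lintegral_swap hm.aemeasurable]
    have : ∀ᵐ ω ∂P, ∫⁻ z, ‖inner ℝ (toEuclideanLin (V ω) z) x‖ₑ ^ (2 * j)
        ∂(stdGaussian (EuclideanSpace ℝ ι)) = ENNReal.ofReal (risF j 1) * ‖x‖ₑ ^ (2 * j) := by
      filter_upwards [hV.2.1] with ω hω
      simp_rw [inner_toEuclideanLin]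
      rw [gauss_lin, ← ofReal_norm, norm_transpose _ hω, ofReal_norm]
    rw [lintegral_congr_ae this]
    simp
  have h2 : ∫⁻ x, linF P V j e x ∂(stdGaussian (EuclideanSpace ℝ (Fin n))) =
      ENNReal.ofReal (risF j 1) * ∫⁻ ω, ‖toEuclideanLin (V ω) e‖ₑ ^ (2 * j) ∂P := by
    unfold linF
    have hm : Measurable (fun q : EuclideanSpace ℝ (Fin n) × Ω =>
        ‖inner ℝ (toEuclideanLin (V q.2) e) q.1‖ₑ ^ (2 * j)) :=
      (((measurable_toEuc' (hV.1.comp measurable_snd) measurable_const).inner measurable_fst).enorm).pow_const _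
    rw [lintegral_lintegral_swap hm.aemeasurable]
    simp_rw [real_inner_comm, gauss_lin]
    rw [lintegral_const_mul' _ _ (by simp)]
  have h3 := lintegral_congr (μ := stdGaussian (EuclideanSpace ℝ (Fin n))) h1
  rw [lintegral_const_mul' _ _ (by simp), lintegral_const_mul' _ _ (by simp),
    lintegral_const_mul' _ _ (by simp), h2, gauss_R, finrank_euclideanSpace, Fintype.card_fin] at h3
  rw [mul_left_comm, mul_left_comm (‖e‖ₑ ^ (2 * j))] at h3
  exact (ENNReal.mul_right_inj (risF_one_ne j) (by simp)).1 h3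

lemma lemA [IsProbabilityMeasure P] (hV : IsUniformStiefel P V) (j : ℕ)
    (y e : EuclideanSpace ℝ ι) (he : e ≠ 0) (hy : inner ℝ e y = 0) :
    ENNReal.ofReal (risF j (Fintype.card ι - 1)) * mixF P V j y e ≤
      ‖y‖ₑ ^ (2 * j) * (ENNReal.ofReal (risF j 1) *
        ∫⁻ ω, ‖toEuclideanLin (V ω) e‖ₑ ^ (2 * j) ∂P) := by
  let H : Submodule ℝ (EuclideanSpace ℝ ι) := (Submodule.span ℝ {e})ᗮ
  have hfin : Module.finrank ℝ H = Fintype.card ι - 1 := by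
    have := Submodule.finrank_add_finrank_orthogonal (Submodule.span ℝ {e})
    rw [finrank_span_singleton he, finrank_euclideanSpace] at this
    have h2 : Module.finrank ℝ H = Module.finrank ℝ ((Submodule.span ℝ {e})ᗮ) := rfl
    omega
  have hR := gauss_R (E := H) j
  rw [hfin] at hR
  rw [← hR, ← lintegral_mul_const _ (by fun_prop)]
  have h1 : ∀ z : H, ‖z‖ₑ ^ (2 * j) * mixF P V j y e = ‖y‖ₑ ^ (2 * j) * mixF P V j (z : EuclideanSpace ℝ ι) e := by
    intro z
    have hz : inner ℝ e (z : EuclideanSpace ℝ ι) = 0 :=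
      Submodule.mem_orthogonal_singleton_iff_inner_right.1 z.2
    exact mixF_homog hV j y z e hy hz
  simp_rw [h1]
  rw [lintegral_const_mul' _ _ (by simp)]
  gcongr
  unfold mixF
  have hm : Measurable (fun q : H × Ω =>
      ‖inner ℝ (toEuclideanLin (V q.2) (q.1 : EuclideanSpace ℝ ι)) (toEuclideanLin (V q.2) e)‖ₑ ^ (2 * j)) :=
    (((measurable_toEuc' (hV.1.comp measurable_snd) (measurable_subtype_coe.comp measurable_fst)).inner
      (measurable_toEuc' (hV.1.comp measurable_snd) measurable_const)).enorm).pow_const _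
  rw [lintegral_lintegral_swap hm.aemeasurable, ← lintegral_const_mul' _ _ (by simp)]
  apply lintegral_mono_ae
  filter_upwards [hV.2.1] with ω hω
  have h2 : ∀ z : H, inner ℝ (toEuclideanLin (V ω) (z : EuclideanSpace ℝ ι)) (toEuclideanLin (V ω) e)
      = inner ℝ z (H.orthogonalProjectionOnto (toEuclideanLin (V ω)ᵀ (toEuclideanLin (V ω) e))) := by
    intro z
    rw [inner_toEuclideanLin, Submodule.inner_orthogonalProjectionOnto_eq_of_mem_left]
  simp_rw [h2]
  rw [gauss_lin]
  gcongr
  rw [← ofReal_norm, ← ofReal_norm]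
  apply ENNReal.ofReal_le_ofReal
  refine (H.norm_orthogonalProjectionOnto_apply_le _).trans ?_
  rw [norm_transpose _ hω]

lemma lemC [IsProbabilityMeasure P] (hV : IsUniformStiefel P V) (j : ℕ)
    (y e : EuclideanSpace ℝ ι) (hj : j ≠ 0) (hy : inner ℝ e y = 0) :
    ENNReal.ofReal (risF j (Fintype.card ι)) * ENNReal.ofReal (risF j (Fintype.card ι - 1)) *
      mixF P V j y e ≤
      ENNReal.ofReal (risF j 1) * ENNReal.ofReal (risF j n) * (‖y‖ₑ ^ (2 * j) * ‖e‖ₑ ^ (2 * j)) := by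
  by_cases he : e = 0
  · subst he
    simp [mixF, hj]
  calc _ = ENNReal.ofReal (risF j (Fintype.card ι)) * (ENNReal.ofReal (risF j (Fintype.card ι - 1)) *
      mixF P V j y e) := by ring
    _ ≤ ENNReal.ofReal (risF j (Fintype.card ι)) * (‖y‖ₑ ^ (2 * j) * (ENNReal.ofReal (risF j 1) *
        ∫⁻ ω, ‖toEuclideanLin (V ω) e‖ₑ ^ (2 * j) ∂P)) := mul_le_mul' le_rfl (lemA hV j y e he hy)
    _ = ‖y‖ₑ ^ (2 * j) * ENNReal.ofReal (risF j 1) * (ENNReal.ofReal (risF j (Fintype.card ι)) * 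
        ∫⁻ ω, ‖toEuclideanLin (V ω) e‖ₑ ^ (2 * j) ∂P) := by ring
    _ = _ := by rw [lemB hV]; ring

end stief

section block
variable {ι κ η : Type*} [Fintype ι] [DecidableEq ι] [Fintype κ] [DecidableEq κ]
  [Fintype η] [DecidableEq η]

/-- selection matrix -/
def selM (f : κ → ι) : Matrix ι κ ℝ := fun i c => if i = f c then 1 else 0

lemma mul_selM {n : ℕ} (V : Matrix (Fin n) ι ℝ) (f : κ → ι) : V * selM f = fun i c => V i (f c) := by
  ext i c
  simp [Matrix.mul_apply, selM]

lemma selM_tr_mul (f : κ → ι) (hf : Function.Injective f) : (selM f)ᵀ * ((selM f)ᵀ)ᵀ = 1 := by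
  ext c c'
  simp only [Matrix.mul_apply, selM, Matrix.transpose_apply, Matrix.one_apply]
  simp [hf.eq_iff, eq_comm]

lemma norm_selM (f : κ → ι) (hf : Function.Injective f) (u : EuclideanSpace ℝ κ) :
    ‖toEuclideanLin (selM f) u‖ = ‖u‖ := by
  simpa using norm_transpose ((selM f)ᵀ) (selM_tr_mul f hf) u

lemma selM_orth (f : κ → ι) (g : η → ι) (hfg : ∀ c c', f c ≠ g c') (u : EuclideanSpace ℝ κ)
    (v : EuclideanSpace ℝ η) :
    inner ℝ (toEuclideanLin (selM g) v) (toEuclideanLin (selM f) u) = 0 := by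
  rw [inner_toEuclideanLin, ← toEuc_mul]
  have : (selM g)ᵀ * selM f = (0 : Matrix η κ ℝ) := by
    ext c c'
    simp only [Matrix.mul_apply, selM, Matrix.transpose_apply]
    simp [hfg c' c]
  rw [this]
  simp

lemma spec_lower (B : Matrix κ η ℝ) (j : ℕ) (hj : j ≠ 0) (r : ℝ) (hr : 0 ≤ r) (h : r ≤ specNorm B) :
    ENNReal.ofReal (risF j 1) * ENNReal.ofReal (risF j 1) * ENNReal.ofReal r ^ (2 * j) ≤
      ∫⁻ v, ∫⁻ u, ‖inner ℝ u (toEuclideanLin B v)‖ₑ ^ (2 * j) ∂(stdGaussian (EuclideanSpace ℝ κ))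
        ∂(stdGaussian (EuclideanSpace ℝ η)) := by
  set H := ∫⁻ v, ∫⁻ u, ‖inner ℝ u (toEuclideanLin B v)‖ₑ ^ (2 * j) ∂(stdGaussian (EuclideanSpace ℝ κ))
        ∂(stdGaussian (EuclideanSpace ℝ η)) with hH
  set a := ENNReal.ofReal (risF j 1) with ha
  have ha0 : a ≠ 0 := risF_one_ne j
  have hat : a ≠ ∞ := by simp [ha]
  have hH' : H = ∫⁻ v, a * ‖toEuclideanLin B v‖ₑ ^ (2 * j) ∂(stdGaussian (EuclideanSpace ℝ η)) := by
    rw [hH]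
    refine lintegral_congr fun v => ?_
    rw [gauss_lin]
  have key : ∀ w : EuclideanSpace ℝ κ,
      a * a * ‖toEuclideanLin Bᵀ w‖ₑ ^ (2 * j) ≤ H * ‖w‖ₑ ^ (2 * j) := by
    intro w
    calc a * a * ‖toEuclideanLin Bᵀ w‖ₑ ^ (2 * j)
        = a * ∫⁻ v, ‖inner ℝ v (toEuclideanLin Bᵀ w)‖ₑ ^ (2 * j) ∂(stdGaussian (EuclideanSpace ℝ η)) := by
          rw [gauss_lin, mul_assoc]
      _ = ∫⁻ v, a * ‖inner ℝ v (toEuclideanLin Bᵀ w)‖ₑ ^ (2 * j) ∂(stdGaussian (EuclideanSpace ℝ η)) := by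
          rw [lintegral_const_mul' _ _ hat]
      _ ≤ ∫⁻ v, (a * ‖toEuclideanLin B v‖ₑ ^ (2 * j)) * ‖w‖ₑ ^ (2 * j) ∂(stdGaussian (EuclideanSpace ℝ η)) := by
          refine lintegral_mono fun v => ?_
          rw [mul_assoc, ← mul_pow, ← inner_toEuclideanLin]
          gcongr
          rw [← ofReal_norm, ← ofReal_norm, ← ofReal_norm, ← ENNReal.ofReal_mul (norm_nonneg _)]
          exact ENNReal.ofReal_le_ofReal (norm_inner_le_norm _ _)
      _ = _ := by rw [lintegral_mul_const' _ _ (by simp), hH']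
  have hT : ∀ v : EuclideanSpace ℝ η,
      a * a * ‖toEuclideanLin B v‖ₑ ^ (2 * j) ≤ H * ‖v‖ₑ ^ (2 * j) := by
    intro v
    by_cases h0 : toEuclideanLin B v = 0
    · rw [h0]; simp [hj]
    have h1 := key (toEuclideanLin B v)
    have h2 : ‖toEuclideanLin B v‖ₑ * ‖toEuclideanLin B v‖ₑ ≤
        ‖v‖ₑ * ‖toEuclideanLin Bᵀ (toEuclideanLin B v)‖ₑ := by
      simp only [← ofReal_norm]
      rw [← ENNReal.ofReal_mul (norm_nonneg _), ← ENNReal.ofReal_mul (norm_nonneg _)]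
      apply ENNReal.ofReal_le_ofReal
      rw [← real_inner_self_eq_norm_mul_norm, inner_toEuclideanLin]
      exact real_inner_le_norm _ _
    have h3 : (a * a * ‖toEuclideanLin B v‖ₑ ^ (2 * j)) * ‖toEuclideanLin B v‖ₑ ^ (2 * j) ≤
        (H * ‖v‖ₑ ^ (2 * j)) * ‖toEuclideanLin B v‖ₑ ^ (2 * j) := by
      calc _ = a * a * (‖toEuclideanLin B v‖ₑ * ‖toEuclideanLin B v‖ₑ) ^ (2 * j) := by
            rw [mul_pow]; ring
        _ ≤ a * a * (‖v‖ₑ * ‖toEuclideanLin Bᵀ (toEuclideanLin B v)‖ₑ) ^ (2 * j) := by gcongr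
        _ = ‖v‖ₑ ^ (2 * j) * (a * a * ‖toEuclideanLin Bᵀ (toEuclideanLin B v)‖ₑ ^ (2 * j)) := by
            rw [mul_pow]; ring
        _ ≤ ‖v‖ₑ ^ (2 * j) * (H * ‖toEuclideanLin B v‖ₑ ^ (2 * j)) := mul_le_mul' le_rfl h1
        _ = _ := by ring
    refine (ENNReal.mul_le_mul_iff_left ?_ ?_).1 h3
    · simp [h0]
    · simp
  have h2j : 2 * j ≠ 0 := by omega
  have haa0 : a * a ≠ 0 := mul_ne_zero ha0 ha0
  have haat : a * a ≠ ∞ := ENNReal.mul_ne_top hat hat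
  set C := (H / (a * a)) ^ (((2 * j : ℕ) : ℝ)⁻¹) with hC
  have hCp : C ^ (2 * j) = H / (a * a) := ENNReal.rpow_inv_natCast_pow h2j _
  have hop : ‖LinearMap.toContinuousLinearMap (Matrix.toEuclideanLin B)‖ₑ ≤ C := by
    refine ContinuousLinearMap.opENorm_le_bound _ fun v => ?_
    refine (ENNReal.pow_right_strictMono h2j).le_iff_le.1 ?_
    show _ ^ (2 * j) ≤ (_ * _) ^ (2 * j)
    rw [mul_pow, hCp]
    rw [← ENNReal.mul_div_right_comm, ENNReal.le_div_iff_mul_le (Or.inl haa0) (Or.inl haat), mul_comm]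
    exact hT v
  have hrC : ENNReal.ofReal r ≤ C := by
    refine le_trans ?_ hop
    rw [← ofReal_norm]
    exact ENNReal.ofReal_le_ofReal h
  calc a * a * ENNReal.ofReal r ^ (2 * j) ≤ a * a * C ^ (2 * j) := by gcongr
    _ = H := by rw [hCp, ENNReal.mul_div_cancel haa0 haat]

variable {Ω : Type*} [MeasurableSpace Ω] {P : Measure Ω} {n : ℕ}
  {V : Ω → Matrix (Fin n) ι ℝ}

/-- bilinear moment integrand -/
def Qf (W : Matrix (Fin n) ι ℝ) (f : κ → ι) (g : η → ι) (j : ℕ) (v : EuclideanSpace ℝ η)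
    (u : EuclideanSpace ℝ κ) : ℝ≥0∞ :=
  ‖inner ℝ (toEuclideanLin W (toEuclideanLin (selM f) u))
      (toEuclideanLin W (toEuclideanLin (selM g) v))‖ₑ ^ (2 * j)

lemma measurable_Qf {α : Type*} [MeasurableSpace α] {W : α → Matrix (Fin n) ι ℝ} (f : κ → ι) (g : η → ι) (j : ℕ)
    {v : α → EuclideanSpace ℝ η} {u : α → EuclideanSpace ℝ κ} (hW : Measurable W) (hv : Measurable v)
    (hu : Measurable u) : Measurable (fun q => Qf (W q) f g j (v q) (u q)) := by
  have m2 := measurable_toEuc' (measurable_const : Measurable (fun _ : α => selM f)) hu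
  have m3 := measurable_toEuc' (measurable_const : Measurable (fun _ : α => selM g)) hv
  have m4 := measurable_toEuc' hW m2
  have m5 := measurable_toEuc' hW m3
  have m6 := ((Measurable.inner (𝕜 := ℝ) m4 m5).enorm).pow_const (2 * j)
  exact m6

lemma measurable_Qf1 (hV : Measurable V) (f : κ → ι) (g : η → ι) (j : ℕ) :
    Measurable (fun q : Ω × EuclideanSpace ℝ η => ∫⁻ u, Qf (V q.1) f g j q.2 u ∂(stdGaussian (EuclideanSpace ℝ κ))) := by
  have : Measurable (fun q : (Ω × EuclideanSpace ℝ η) × EuclideanSpace ℝ κ => Qf (V q.1.1) f g j q.1.2 q.2) :=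
    measurable_Qf f g j (hV.comp measurable_fst.fst) measurable_fst.snd measurable_snd
  exact this.lintegral_prod_right'

lemma measurable_Qf2 (hV : Measurable V) (f : κ → ι) (g : η → ι) (j : ℕ) :
    Measurable (fun ω => ∫⁻ v, ∫⁻ u, Qf (V ω) f g j v u ∂(stdGaussian (EuclideanSpace ℝ κ))
      ∂(stdGaussian (EuclideanSpace ℝ η))) :=
  (measurable_Qf1 hV f g j).lintegral_prod_right'

lemma Qf_swap [IsProbabilityMeasure P] (hV : Measurable V) (f : κ → ι) (g : η → ι) (j : ℕ) :
    ∫⁻ ω, ∫⁻ v, ∫⁻ u, Qf (V ω) f g j v u ∂(stdGaussian (EuclideanSpace ℝ κ))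
      ∂(stdGaussian (EuclideanSpace ℝ η)) ∂P =
      ∫⁻ v, ∫⁻ u, mixF P V j (toEuclideanLin (selM f) u) (toEuclideanLin (selM g) v)
        ∂(stdGaussian (EuclideanSpace ℝ κ)) ∂(stdGaussian (EuclideanSpace ℝ η)) := by
  rw [lintegral_lintegral_swap (measurable_Qf1 hV f g j).aemeasurable]
  refine lintegral_congr fun v => ?_
  have : Measurable (fun q : Ω × EuclideanSpace ℝ κ => Qf (V q.1) f g j v q.2) :=
    measurable_Qf f g j (hV.comp measurable_fst) measurable_const measurable_snd
  rw [lintegral_lintegral_swap this.aemeasurable]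
  rfl

lemma Qf_lower (hV : Measurable V) (f : κ → ι) (g : η → ι) (j : ℕ) (hj : j ≠ 0) (r : ℝ) (hr : 0 ≤ r) :
    ENNReal.ofReal (risF j 1) * ENNReal.ofReal (risF j 1) * ENNReal.ofReal r ^ (2 * j) *
        P {ω | r ≤ specNorm ((V ω * selM f)ᵀ * (V ω * selM g))} ≤
      ∫⁻ ω, ∫⁻ v, ∫⁻ u, Qf (V ω) f g j v u ∂(stdGaussian (EuclideanSpace ℝ κ))
      ∂(stdGaussian (EuclideanSpace ℝ η)) ∂P := by
  refine le_trans ?_ (mul_meas_ge_le_lintegral (measurable_Qf2 hV f g j)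
    (ENNReal.ofReal (risF j 1) * ENNReal.ofReal (risF j 1) * ENNReal.ofReal r ^ (2 * j)))
  refine mul_le_mul' le_rfl (measure_mono ?_)
  intro ω hω
  refine (spec_lower _ j hj r hr hω).trans_eq ?_
  refine lintegral_congr fun v => lintegral_congr fun u => ?_
  unfold Qf
  rw [toEuc_mul, toEuc_mul, ← inner_toEuclideanLin, toEuc_mul]

lemma tail_enn [IsProbabilityMeasure P] (hV : IsUniformStiefel P V) (f : κ → ι) (g : η → ι)
    (hf : Function.Injective f) (hg : Function.Injective g) (hfg : ∀ c c', f c ≠ g c')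
    (j : ℕ) (hj : j ≠ 0) (r : ℝ) (hr : 0 ≤ r) :
    ENNReal.ofReal (risF j (Fintype.card ι)) * ENNReal.ofReal (risF j (Fintype.card ι - 1)) *
      (ENNReal.ofReal (risF j 1) * ENNReal.ofReal (risF j 1) * ENNReal.ofReal r ^ (2 * j) *
        P {ω | r ≤ specNorm ((V ω * selM f)ᵀ * (V ω * selM g))}) ≤
      ENNReal.ofReal (risF j 1) * ENNReal.ofReal (risF j n) *
        (ENNReal.ofReal (risF j (Fintype.card κ)) * ENNReal.ofReal (risF j (Fintype.card η))) := by
  set a := ENNReal.ofReal (risF j 1) with ha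
  refine (mul_le_mul' le_rfl ((Qf_lower hV.1 f g j hj r hr).trans_eq (Qf_swap hV.1 f g j))).trans ?_
  rw [← lintegral_const_mul' _ _ (ENNReal.mul_ne_top (by simp) (by simp))]
  have hb : ∀ (v : EuclideanSpace ℝ η), ENNReal.ofReal (risF j (Fintype.card ι)) * ENNReal.ofReal (risF j (Fintype.card ι - 1)) *
      ∫⁻ u, mixF P V j (toEuclideanLin (selM f) u) (toEuclideanLin (selM g) v)
        ∂(stdGaussian (EuclideanSpace ℝ κ)) ≤ 
      a * ENNReal.ofReal (risF j n) * (ENNReal.ofReal (risF j (Fintype.card κ)) * ‖v‖ₑ ^ (2 * j)) := by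
    intro v
    rw [← lintegral_const_mul' _ _ (ENNReal.mul_ne_top (by simp) (by simp))]
    calc _ ≤ ∫⁻ u, a * ENNReal.ofReal (risF j n) * (‖u‖ₑ ^ (2 * j) * ‖v‖ₑ ^ (2 * j))
          ∂(stdGaussian (EuclideanSpace ℝ κ)) := by
          refine lintegral_mono fun u => ?_
          refine (lemC hV j _ _ hj (selM_orth f g hfg u v)).trans_eq ?_
          simp only [← ofReal_norm, norm_selM f hf, norm_selM g hg]
          rfl
      _ = _ := by
          rw [lintegral_const_mul' _ _ (ENNReal.mul_ne_top (by simp [ha]) (by simp)),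
            lintegral_mul_const' _ _ (by simp), gauss_R, finrank_euclideanSpace]
  refine (lintegral_mono hb).trans_eq ?_
  rw [lintegral_const_mul' _ _ (ENNReal.mul_ne_top (by simp [ha]) (by simp)),
    lintegral_const_mul' _ _ (by simp), gauss_R, finrank_euclideanSpace]

end block

section realpart

lemma prod_upper (c : ℝ) (hc : 0 < c) (j : ℕ) :
    ∏ i ∈ Finset.range j, (c + 2 * (i : ℝ)) ≤ (c + j - 1) ^ j := by
  induction j with
  | zero => simp
  | succ j ih =>
    rw [Finset.prod_range_succ]
    rcases Nat.eq_zero_or_pos j with rfl | hj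
    · simp
    have hj1 : (1 : ℝ) ≤ j := by exact_mod_cast hj
    set x : ℝ := c + j - 1 with hx
    have hx0 : 0 < x := by linarith
    have hb : 1 + ((j + 1 : ℕ) : ℝ) * (1 / x) ≤ (1 + 1 / x) ^ (j + 1) :=
      one_add_mul_le_pow (by have : 0 < 1 / x := by positivity
                             linarith) (j + 1)
    have h2 : (c + ((j + 1 : ℕ) : ℝ) - 1) = x * (1 + 1 / x) := by
      field_simp; push_cast; linarith
    rw [h2, mul_pow]
    calc _ ≤ x ^ j * (c + 2 * j) := by gcongr
      _ = x ^ (j + 1) * (1 + ((j + 1 : ℕ) : ℝ) * (1 / x)) := by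
        rw [pow_succ]; field_simp; push_cast; rw [hx]; ring
      _ ≤ _ := by gcongr

lemma risF_nonneg (j N : ℕ) : 0 ≤ risF j N := by
  unfold risF; positivity

lemma risF_one_lower (j : ℕ) : (2 * (j : ℝ) / 3) ^ j ≤ risF j 1 := by
  induction j with
  | zero => simp [risF]
  | succ j ih =>
    have hs : risF (j + 1) 1 = risF j 1 * (1 + 2 * j) := by
      simp [risF, Finset.prod_range_succ]
    rw [hs]
    by_cases h4 : j ≤ 4
    · interval_cases j <;> norm_num [risF, Finset.prod_range_succ]
    push Not at h4
    have hj5 : (5 : ℝ) ≤ j := by exact_mod_cast h4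
    have h1 : (1 + 1 / (j : ℝ)) ^ j ≤ Real.exp 1 := by
      calc (1 + 1 / (j : ℝ)) ^ j ≤ (Real.exp (1 / j)) ^ j := by
            gcongr
            linarith [Real.add_one_le_exp (1 / (j : ℝ))]
        _ = Real.exp 1 := by
            rw [← Real.exp_nat_mul]; congr 1; field_simp
    have he := Real.exp_one_lt_d9
    have h2 : (2 * ((j + 1 : ℕ) : ℝ) / 3) = (2 * (j : ℝ) / 3) * (1 + 1 / j) := by
      push_cast; field_simp
    calc (2 * ((j + 1 : ℕ) : ℝ) / 3) ^ (j + 1)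
        = (2 * (j : ℝ) / 3) ^ j * ((1 + 1 / (j : ℝ)) ^ j * (2 * ((j : ℝ) + 1) / 3)) := by
          rw [pow_succ]; nth_rewrite 1 [h2]; rw [mul_pow]; push_cast; ring
      _ ≤ risF j 1 * (1 + 2 * j) := by
          refine mul_le_mul ih ?_ (by positivity) (risF_nonneg j 1)
          calc _ ≤ Real.exp 1 * (2 * ((j : ℝ) + 1) / 3) := by gcongr
            _ ≤ 2.7182818286 * (2 * ((j : ℝ) + 1) / 3) := by gcongr
            _ ≤ _ := by linarith

lemma risF_lower (j N : ℕ) : (N : ℝ) ^ j ≤ risF j N := by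
  unfold risF
  calc (N : ℝ) ^ j = ∏ i ∈ Finset.range j, (N : ℝ) := by simp
    _ ≤ _ := Finset.prod_le_prod (by intros; positivity) (by intro i _; have : (0:ℝ) ≤ i := by positivity
                                                             linarith)

lemma risF_mul_upper (j k d : ℕ) (hd : 1 ≤ d) :
    risF j k * risF j d ≤ (((k : ℝ) + d) / 2 + j - 1) ^ (2 * j) := by
  have hd' : (1 : ℝ) ≤ d := by exact_mod_cast hd
  have h := prod_upper (((k : ℝ) + d) / 2) (by positivity) j
  unfold risF
  rw [← Finset.prod_mul_distrib]
  calc _ ≤ ∏ i ∈ Finset.range j, (((k : ℝ) + d) / 2 + 2 * (i : ℝ)) ^ 2 := by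
        refine Finset.prod_le_prod (by intros; positivity) ?_
        intro i _
        nlinarith [sq_nonneg ((k : ℝ) - d)]
    _ = (∏ i ∈ Finset.range j, (((k : ℝ) + d) / 2 + 2 * (i : ℝ))) ^ 2 := by
        rw [Finset.prod_pow]
    _ ≤ ((((k : ℝ) + d) / 2 + j - 1) ^ j) ^ 2 := by
        gcongr
    _ = _ := by rw [← pow_mul, mul_comm]

lemma exp_aux (μ : ℝ) (hμ0 : 0 ≤ μ) (hμ1 : μ ≤ 1) : (1 + μ) ^ 2 / 8 ≤ Real.exp (μ - 1) := by
  have e2 : (1 + μ) ^ 2 ≤ Real.exp μ ^ 2 := by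
    gcongr
    linarith [Real.add_one_le_exp μ]
  have e3 : Real.exp μ ≤ Real.exp 1 := Real.exp_le_exp.2 hμ1
  have he := Real.exp_one_lt_d9
  have e4 : Real.exp (μ - 1) = Real.exp μ / Real.exp 1 := Real.exp_sub _ _
  have e0 := Real.exp_pos μ
  have e01 := Real.exp_pos 1
  rw [e4, le_div_iff₀ e01]
  have e5 : Real.exp μ * Real.exp 1 ≤ 8 := by
    calc Real.exp μ * Real.exp 1 ≤ 2.7182818286 * 2.7182818286 := by
          apply mul_le_mul <;> linarith
      _ ≤ 8 := by norm_num
  calc (1 + μ) ^ 2 / 8 * Real.exp 1 ≤ Real.exp μ ^ 2 / 8 * Real.exp 1 := by gcongr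
    _ = Real.exp μ * (Real.exp μ * Real.exp 1) / 8 := by ring
    _ ≤ Real.exp μ * 8 / 8 := by gcongr
    _ = Real.exp μ := by ring

lemma real_bound (n N k d : ℕ) (S τ r : ℝ) (hd : 1 ≤ d) (hN : 2 ≤ N) (hτ : 0 ≤ τ)
    (hS : S = Real.sqrt ((k : ℝ) + d) + τ) (hSn : S ^ 2 ≤ n) (hr : 0 < r)
    (hb : 9 * S ^ 2 * n ≤ (N : ℝ) * ((N - 1 : ℕ) : ℝ) * r ^ 2) :
    ∃ j : ℕ, j ≠ 0 ∧ risF j n * (risF j k * risF j d) /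
      (risF j 1 * (risF j N * risF j (N - 1) * r ^ (2 * j))) ≤ Real.exp (-τ ^ 2 / 2) := by
  set m : ℝ := (k : ℝ) + d with hm
  have hd' : (1 : ℝ) ≤ d := by exact_mod_cast hd
  have hm1 : 1 ≤ m := by rw [hm]; have : (0:ℝ) ≤ k := by positivity
                         linarith
  have hsm : Real.sqrt m ^ 2 = m := Real.sq_sqrt (by linarith)
  have hsm0 : 0 ≤ Real.sqrt m := Real.sqrt_nonneg _
  have hS2 : m + τ ^ 2 ≤ S ^ 2 := by rw [hS]; nlinarith [mul_nonneg hsm0 hτ]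
  set s := S ^ 2 with hs
  have hs1 : 1 ≤ s := by nlinarith
  have hs0 : 0 < s := by linarith
  obtain ⟨j, hjdef⟩ : ∃ j, j = ⌈s / 2⌉₊ := ⟨_, rfl⟩
  have hj0 : j ≠ 0 := by
    rw [hjdef]; exact (Nat.ceil_pos.2 (by positivity)).ne'
  have hj1 : s / 2 ≤ j := by rw [hjdef]; exact Nat.le_ceil _
  have hj2 : (j : ℝ) - 1 ≤ s / 2 := by
    rw [hjdef]; linarith [Nat.ceil_lt_add_one (a := s / 2) (by positivity)]
  have hjpos : (0 : ℝ) < j := by linarith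
  have hn1 : (1 : ℝ) ≤ n := by linarith
  refine ⟨j, hj0, ?_⟩
  have hN1 : (1 : ℝ) ≤ ((N - 1 : ℕ) : ℝ) := by
    have : 1 ≤ N - 1 := by omega
    exact_mod_cast this
  have hN2 : (2 : ℝ) ≤ N := by exact_mod_cast hN
  have u1 : risF j n ≤ (3 / 2 * n) ^ j := by
    refine (prod_upper n (by linarith) j).trans ?_
    apply pow_le_pow_left₀ <;> linarith
  have u2 : risF j k * risF j d ≤ (((m + s) / 2) ^ 2) ^ j := by
    refine (risF_mul_upper j k d hd).trans ?_
    rw [← pow_mul]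
    apply pow_le_pow_left₀ <;> linarith
  have l1 := risF_one_lower j
  have l2 := risF_lower j N
  have l3 := risF_lower j (N - 1)
  set M : ℝ := (N : ℝ) * ((N - 1 : ℕ) : ℝ) * r ^ 2 with hM
  have hM0 : 0 < M := by positivity
  have l4 : (s / 3 * M) ^ j ≤ risF j 1 * (risF j N * risF j (N - 1) * r ^ (2 * j)) := by
    rw [mul_pow]
    have : M ^ j = (N : ℝ) ^ j * ((N - 1 : ℕ) : ℝ) ^ j * r ^ (2 * j) := by
      rw [hM, mul_pow, mul_pow, ← pow_mul]
    rw [this]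
    have hA : (s / 3) ^ j ≤ risF j 1 := by
      refine le_trans ?_ l1
      apply pow_le_pow_left₀ <;> linarith
    have hn0 := risF_nonneg j 1
    have hn2 := risF_nonneg j N
    gcongr
  have hq : risF j n * (risF j k * risF j d) /
      (risF j 1 * (risF j N * risF j (N - 1) * r ^ (2 * j))) ≤
      ((3 / 2 * n) ^ j * (((m + s) / 2) ^ 2) ^ j) / (s / 3 * M) ^ j := by
    have := risF_nonneg j k
    have := risF_nonneg j d
    gcongr
  refine hq.trans ?_
  rw [← mul_pow, ← div_pow]
  set μ : ℝ := m / s with hμ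
  have hμ1 : μ ≤ 1 := by rw [hμ, div_le_one hs0]; nlinarith [sq_nonneg τ]
  have hμ0 : 0 ≤ μ := by positivity
  have base : (3 / 2 * n * ((m + s) / 2) ^ 2) / (s / 3 * M) ≤ Real.exp (μ - 1) := by
    have e1 : (3 / 2 * n * ((m + s) / 2) ^ 2) / (s / 3 * M) ≤ (1 + μ) ^ 2 / 8 := by
      have hms : m = μ * s := by rw [hμ]; field_simp
      rw [div_le_iff₀ (by positivity), hms]
      have h9 : 0 ≤ (1 + μ) ^ 2 * s / 24 * (M - 9 * s * n) := by
        apply mul_nonneg (by positivity); linarith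
      have h10 : (1 + μ) ^ 2 / 8 * (s / 3 * M) - 3 / 2 * n * ((μ * s + s) / 2) ^ 2 =
        (1 + μ) ^ 2 * s / 24 * (M - 9 * s * n) := by ring
      linarith
    exact e1.trans (exp_aux μ hμ0 hμ1)
  calc _ ≤ Real.exp (μ - 1) ^ j := by
        apply pow_le_pow_left₀ (by positivity) base
    _ = Real.exp (j * (μ - 1)) := by rw [Real.exp_nat_mul]
    _ ≤ _ := by
        apply Real.exp_le_exp.2
        have : (j : ℝ) * (μ - 1) ≤ s / 2 * (μ - 1) := by
          apply mul_le_mul_of_nonpos_right hj1; linarith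
        have h3 : s * μ = m := by rw [hμ]; field_simp
        linarith

end realpart

lemma tail_real {ι κ η : Type*} [Fintype ι] [DecidableEq ι] [Fintype κ] [DecidableEq κ]
    [Fintype η] [DecidableEq η] {Ω : Type*} [MeasurableSpace Ω] {P : Measure Ω} {n : ℕ}
    {V : Ω → Matrix (Fin n) ι ℝ} [IsProbabilityMeasure P] (hV : IsUniformStiefel P V) (f : κ → ι)
    (g : η → ι) (hf : Function.Injective f) (hg : Function.Injective g) (hfg : ∀ c c', f c ≠ g c')
    (S τ r : ℝ) (hd : 1 ≤ Fintype.card η) (hN : 2 ≤ Fintype.card ι) (hτ : 0 ≤ τ)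
    (hS : S = Real.sqrt ((Fintype.card κ : ℝ) + Fintype.card η) + τ) (hSn : S ^ 2 ≤ n) (hr : 0 < r)
    (hb : 9 * S ^ 2 * n ≤ (Fintype.card ι : ℝ) * ((Fintype.card ι - 1 : ℕ) : ℝ) * r ^ 2) :
    P {ω | r ≤ specNorm ((V ω * selM f)ᵀ * (V ω * selM g))} ≤
      ENNReal.ofReal (Real.exp (-τ ^ 2 / 2)) := by
  obtain ⟨j, hj, hle⟩ := real_bound n _ _ _ S τ r hd hN hτ hS hSn hr hb
  have ht := tail_enn hV f g hf hg hfg j hj r hr.le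
  set E := {ω | r ≤ specNorm ((V ω * selM f)ᵀ * (V ω * selM g))}
  have hE : P E = ENNReal.ofReal (P.real E) := by simp [Measure.real]
  set x := P.real E with hx
  have hx0 : 0 ≤ x := measureReal_nonneg
  have p1 : 0 < risF j 1 := by unfold risF; positivity
  have hNp : 0 < (Fintype.card ι : ℝ) := by
    have : 0 < Fintype.card ι := by omega
    exact_mod_cast this
  have hNp1 : 0 < ((Fintype.card ι - 1 : ℕ) : ℝ) := by
    have : 0 < Fintype.card ι - 1 := by omega
    exact_mod_cast this
  have p2 : 0 < risF j (Fintype.card ι) := lt_of_lt_of_le (by positivity) (risF_lower j _)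
  have p3 : 0 < risF j (Fintype.card ι - 1) := lt_of_lt_of_le (by positivity) (risF_lower j _)
  have p4 := risF_nonneg j n
  have p5 := risF_nonneg j (Fintype.card κ)
  have p6 := risF_nonneg j (Fintype.card η)
  rw [hE, ← ENNReal.ofReal_pow hr.le, ← ENNReal.ofReal_mul p1.le, ← ENNReal.ofReal_mul (by positivity),
    ← ENNReal.ofReal_mul (by positivity), ← ENNReal.ofReal_mul (by positivity),
    ← ENNReal.ofReal_mul (by positivity), ← ENNReal.ofReal_mul (by positivity),
    ← ENNReal.ofReal_mul (by positivity), ← ENNReal.ofReal_mul (by positivity),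
    ENNReal.ofReal_le_ofReal_iff (by positivity)] at ht
  rw [hE]
  apply ENNReal.ofReal_le_ofReal
  refine le_trans ?_ hle
  rw [le_div_iff₀ (by positivity)]
  refine le_of_mul_le_mul_left ?_ p1
  calc _ = risF j (Fintype.card ι) * risF j (Fintype.card ι - 1) *
      (risF j 1 * risF j 1 * r ^ (2 * j) * x) := by ring
    _ ≤ _ := ht
    _ = _ := by ring

lemma threshold_bound (n N : ℕ) (S T w t₁₀ u : ℝ) (hn : 1 ≤ n) (hN : 2 ≤ N)
    (hS : 0 ≤ S) (hw : 1 / (N : ℝ) ≤ w) (ht : 0 < t₁₀) (h3 : w + t₁₀ < 1 / 3) (hu : 0 ≤ u)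
    (hT : T = (3 * (S / Real.sqrt n) + u) / (1 - 3 * (w + t₁₀))) :
    9 * S ^ 2 * n ≤ (N : ℝ) * ((N - 1 : ℕ) : ℝ) * (T * (n / N)) ^ 2 := by
  have hn' : (1 : ℝ) ≤ n := by exact_mod_cast hn
  have hN' : (2 : ℝ) ≤ N := by exact_mod_cast hN
  have hc : ((N - 1 : ℕ) : ℝ) = N - 1 := by
    rw [Nat.cast_sub (by omega)]; simp
  rw [hc]
  have hsn : 0 < Real.sqrt n := Real.sqrt_pos.2 (by linarith)
  have hsn2 : Real.sqrt n ^ 2 = n := Real.sq_sqrt (by linarith)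
  have hD : 0 < 1 - 3 * (w + t₁₀) := by linarith
  have hw0 : 0 < 1 / (N : ℝ) := by positivity
  have hD2 : 1 - 3 * (w + t₁₀) ≤ 1 - 1 / N := by linarith
  have hD3 : (0 : ℝ) < 1 - 1 / N := by linarith
  have hT1 : 3 * (S / Real.sqrt n) / (1 - 1 / N) ≤ T := by
    rw [hT]
    apply div_le_div₀ _ _ hD hD2
    · positivity
    · linarith
  have hT1' : 3 * (S / Real.sqrt n) / (1 - 1 / N) = 3 * S / Real.sqrt n * (N / (N - 1)) := by
    have : (N : ℝ) - 1 ≠ 0 := by linarith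
    have h2 : (1 : ℝ) - 1 / N ≠ 0 := hD3.ne'
    field_simp
  have hT0 : 0 ≤ 3 * (S / Real.sqrt n) / (1 - 1 / N) := by positivity
  have hN1 : (0 : ℝ) < N - 1 := by linarith
  calc 9 * S ^ 2 * n ≤ 9 * S ^ 2 * n * (N / (N - 1)) := by
        apply le_mul_of_one_le_right (by positivity)
        rw [one_le_div hN1]; linarith
    _ = (N : ℝ) * (N - 1) * ((3 * (S / Real.sqrt n) / (1 - 1 / N)) * (n / N)) ^ 2 := by
        rw [hT1']
        have : (3 * S / Real.sqrt n * (N / (N - 1)) * (n / N)) ^ 2 =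
            9 * S ^ 2 * n ^ 2 / (Real.sqrt n ^ 2 * (N - 1) ^ 2) := by
          field_simp; ring
        rw [this, hsn2]
        field_simp
    _ ≤ _ := by gcongr

lemma specNorm_smul {κ η : Type*} [Fintype κ] [Fintype η] [DecidableEq η] (c : ℝ) (hc : 0 ≤ c)
    (B : Matrix κ η ℝ) : specNorm (c • B) = c * specNorm B := by
  unfold specNorm
  rw [map_smul, map_smul, norm_smul, Real.norm_of_nonneg hc]

/-- **Lemma S.4.** Uniform cross-Gram concentration between a block set `A` (`|A| = a`)
and each of `q` blocks `k ∈ K` disjoint from `A`, for a uniform Stiefel matrix. -/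
theorem stiefel_max_cross_gram_concentration
    {Ω : Type*} [MeasurableSpace Ω] (P : Measure Ω) [IsProbabilityMeasure P]
    (n p d a q : ℕ) (V : Ω → Matrix (Fin n) (Fin p × Fin d) ℝ)
    (hV : IsUniformStiefel P V)
    (A K : Finset (Fin p)) (hA : A.card = a) (hK : K.card = q) (hAK : Disjoint A K)
    (hpad : n ≤ (p - a - 1) * d)
    (t₈ t₉ t₁₀ : ℝ) (ht₈ : 0 < t₈) (ht₉ : 0 < t₉) (ht₁₀ : 0 < t₁₀)
    (h₁ : Real.sqrt (((a + 1) * d : ℕ) / (n : ℝ)) + t₈ < 1)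
    (h₂ : Real.sqrt (((a : ℝ) + 1) / p) + t₉ < 1)
    (h₃ : Real.sqrt (((a : ℝ) + 1) / p) + t₁₀ < 1 / 3) :
    P {ω | ∃ k ∈ K,
          (3 * (Real.sqrt (((a + 1) * d : ℕ) / (n : ℝ)) + t₈)
              + 3 * (Real.sqrt (((a : ℝ) + 1) / p) + t₉))
            / (1 - 3 * (Real.sqrt (((a : ℝ) + 1) / p) + t₁₀))
          ≤ specNorm (((p * d : ℕ) / (n : ℝ)) • ((blockCols (V ω) A)ᵀ * colBlock (V ω) k))}
      ≤ (q : ℝ≥0∞) * ENNReal.ofReal (2 * Real.exp (-(n : ℝ) * t₈ ^ 2 / 2)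
          + 2 * Real.exp (-((p * d : ℕ) : ℝ) * t₉ ^ 2 / 2)
          + Real.exp (-((p * d : ℕ) : ℝ) * t₁₀ ^ 2 / 2)) := by
  set w := Real.sqrt (((a : ℝ) + 1) / p) with hw
  have hw0 : 0 ≤ w := Real.sqrt_nonneg _
  set v := Real.sqrt (((a + 1) * d : ℕ) / (n : ℝ)) with hv
  have hv0 : 0 ≤ v := Real.sqrt_nonneg _
  set T := (3 * (v + t₈) + 3 * (w + t₉)) / (1 - 3 * (w + t₁₀)) with hT
  have hTpos : 0 < T := by
    rw [hT]; apply div_pos <;> linarith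
  have hset : {ω | ∃ k ∈ K, T ≤ specNorm (((p * d : ℕ) / (n : ℝ)) •
      ((blockCols (V ω) A)ᵀ * colBlock (V ω) k))} =
      ⋃ k ∈ K, {ω | T ≤ specNorm (((p * d : ℕ) / (n : ℝ)) •
      ((blockCols (V ω) A)ᵀ * colBlock (V ω) k))} := by
    ext ω; simp
  rw [hset]
  refine (measure_biUnion_finset_le _ _).trans ?_
  have hterm : ∀ k ∈ K, P {ω | T ≤ specNorm (((p * d : ℕ) / (n : ℝ)) •
      ((blockCols (V ω) A)ᵀ * colBlock (V ω) k))} ≤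
      ENNReal.ofReal (2 * Real.exp (-(n : ℝ) * t₈ ^ 2 / 2)
          + 2 * Real.exp (-((p * d : ℕ) : ℝ) * t₉ ^ 2 / 2)
          + Real.exp (-((p * d : ℕ) : ℝ) * t₁₀ ^ 2 / 2)) := by
    intro k hk
    rcases Nat.eq_zero_or_pos n with hn | hn
    · have : {ω | T ≤ specNorm (((p * d : ℕ) / (n : ℝ)) •
          ((blockCols (V ω) A)ᵀ * colBlock (V ω) k))} = ∅ := by
        ext ω
        simp only [Set.mem_setOf_eq, Set.mem_empty_iff_false, iff_false, not_le]
        have hn0 : (n : ℝ) = 0 := by exact_mod_cast hn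
        rw [specNorm_smul _ (by positivity), hn0]
        simpa using hTpos
      rw [this]; simp
    have hd : 1 ≤ d := by
      rcases Nat.eq_zero_or_pos d with h | h
      · subst h; omega
      · exact h
    have hpa : 1 ≤ p - a - 1 := by
      rcases Nat.eq_zero_or_pos (p - a - 1) with h | h
      · rw [h] at hpad; omega
      · exact h
    have hp : 2 ≤ p := by omega
    have hN : 2 ≤ p * d := by nlinarith
    have hn' : (0 : ℝ) < n := by exact_mod_cast hn
    have hN' : (0 : ℝ) < ((p * d : ℕ) : ℝ) := by
      have : 0 < p * d := by omega
      exact_mod_cast this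
    have hkA : k ∉ A := fun h => Finset.disjoint_left.1 hAK h hk
    have hsn : 0 < Real.sqrt n := Real.sqrt_pos.2 hn'
    have hsn2 : Real.sqrt n ^ 2 = n := Real.sq_sqrt hn'.le
    have hvS : Real.sqrt n * v = Real.sqrt (((a + 1) * d : ℕ) : ℝ) := by
      rw [hv, ← Real.sqrt_mul hn'.le]; congr 1; field_simp
    let f : {j // j ∈ A} × Fin d → Fin p × Fin d := fun jk => (jk.1.1, jk.2)
    let g : Fin d → Fin p × Fin d := fun l => (k, l)
    have hf : Function.Injective f := by
      rintro ⟨⟨x, hx⟩, l⟩ ⟨⟨y, hy⟩, l'⟩ h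
      simp only [f, Prod.mk.injEq] at h
      obtain ⟨rfl, rfl⟩ := h
      rfl
    have hg : Function.Injective g := fun l l' h => (Prod.mk.inj h).2
    have hfg : ∀ c c', f c ≠ g c' := by
      rintro ⟨⟨x, hx⟩, l⟩ l' h
      have := (Prod.mk.inj h).1
      subst this
      exact hkA hx
    have hci : Fintype.card (Fin p × Fin d) = p * d := by simp
    have hck : Fintype.card ({j // j ∈ A} × Fin d) = a * d := by simp [hA]
    have hce : Fintype.card (Fin d) = d := by simp
    have hmain := tail_real hV f g hf hg hfg (Real.sqrt n * (v + t₈)) (Real.sqrt n * t₈)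
      (T * (n / ((p * d : ℕ) : ℝ))) (by rw [hce]; exact hd) (by rw [hci]; exact hN) (by positivity)
      (by
        rw [hck, hce, mul_add, hvS]
        congr 2
        push_cast; ring)
      (by
        rw [mul_pow, hsn2]
        have : (v + t₈) ^ 2 ≤ 1 := by nlinarith
        nlinarith)
      (by positivity)
      (by
        rw [hci]
        refine threshold_bound n (p * d) _ T w t₁₀ (3 * (w + t₉)) hn hN (by positivity) ?_ ht₁₀ h₃
          (by positivity) ?_
        · have hp' : (2 : ℝ) ≤ p := by exact_mod_cast hp
          have hd' : (1 : ℝ) ≤ d := by exact_mod_cast hd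
          have ha0 : (0 : ℝ) ≤ a := by positivity
          rw [hw]
          apply Real.le_sqrt_of_sq_le
          push_cast
          have h1 : 1 / ((p : ℝ) * d) ≤ 1 / p := by
            apply one_div_le_one_div_of_le (by linarith)
            nlinarith
          have h2 : 1 / (p : ℝ) ≤ 1 := by
            rw [div_le_one (by linarith)]; linarith
          have h3 : 0 ≤ 1 / ((p : ℝ) * d) := by positivity
          have h4 : 1 / (p : ℝ) ≤ ((a : ℝ) + 1) / p := by
            gcongr; linarith
          nlinarith
        · rw [mul_div_cancel_left₀ _ hsn.ne'])
    refine le_trans (measure_mono ?_) (hmain.trans (ENNReal.ofReal_le_ofReal ?_))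
    · intro ω hω
      have h1 : blockCols (V ω) A = V ω * selM f := by rw [mul_selM]; rfl
      have h2 : colBlock (V ω) k = V ω * selM g := by rw [mul_selM]; rfl
      simp only [Set.mem_setOf_eq] at hω ⊢
      rw [specNorm_smul _ (by positivity), h1, h2] at hω
      set y := specNorm ((V ω * selM f)ᵀ * (V ω * selM g))
      calc T * (n / ((p * d : ℕ) : ℝ)) ≤ ((p * d : ℕ) / (n : ℝ) * y) * (n / ((p * d : ℕ) : ℝ)) := by
            gcongr
        _ = y := by field_simp
    · have e1 : -(Real.sqrt n * t₈) ^ 2 / 2 = -(n : ℝ) * t₈ ^ 2 / 2 := by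
        rw [mul_pow, hsn2]; ring
      rw [e1]
      have := Real.exp_pos (-(n : ℝ) * t₈ ^ 2 / 2)
      have := Real.exp_pos (-((p * d : ℕ) : ℝ) * t₉ ^ 2 / 2)
      have := Real.exp_pos (-((p * d : ℕ) : ℝ) * t₁₀ ^ 2 / 2)
      linarith
  refine (Finset.sum_le_sum hterm).trans_eq ?_
  rw [Finset.sum_const, hK, nsmul_eq_mul]
end
end

section
/- Let V be an n×(p·d) random real matrix uniformly distributed on the Stiefel manifold V(n, p·d), with columns partitioned into p consecutive blocks of d columns. Let A ⊆ {1,…,p} with |A| = a, K ⊆ {1,…,p} \ A with |K| = q, and let s ≥ 1 be an integer. Suppose (p − a − 1)·d ≥ n, √((a+1)d/n) ≤ 1/(120√s), and √((a+1)/p) ≤ 1/(120√s). Then P[ max_{k∈K} ‖(p d/n)·V_Aᵀ V_k‖ ≥ 1/(7√s) ] ≤ 5 q·exp(−n/(28800 s)). -/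
open MeasureTheory ProbabilityTheory Filter Matrix
open scoped ENNReal NNReal

noncomputable section

/-- The deviation quadratic form. -/
def phiDev {ι : Type*} [Fintype ι] {n : ℕ} (t : ℝ) (M : Matrix (Fin n) ι ℝ) (x : ι → ℝ) : ℝ :=
  (M *ᵥ x) ⬝ᵥ (M *ᵥ x) - t * (x ⬝ᵥ x)

lemma one_sub_inv_sqrt_le (c : ℝ) (hc : |c| ≤ 1 / 3) :
    Real.sqrt (1 / (1 - c)) ≤ Real.exp ((c + c ^ 2) / 2) := by
  have h1 := abs_le.1 hc
  have hl := Real.abs_log_sub_add_sum_range_le (x := c) (by linarith) 2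
  have h3 : |c| ^ (2 + 1) / (1 - |c|) ≤ c ^ 2 / 2 := by
    rw [div_le_iff₀ (by linarith), ← sq_abs c]
    nlinarith [sq_nonneg |c|, abs_nonneg c]
  have h4 := (abs_le.1 (hl.trans h3)).1
  simp [Finset.sum_range_succ] at h4
  have h5 : Real.log (1 / (1 - c)) ≤ c + c ^ 2 := by
    rw [one_div, Real.log_inv]; linarith
  rw [Real.sqrt_le_left (by positivity), ← Real.exp_nat_mul]
  have hp : 0 < 1 / (1 - c) := by apply one_div_pos.2; linarith
  rw [← Real.log_le_iff_le_exp hp] 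
  push_cast; linarith

lemma gauss_one (c : ℝ) (hc : |c| ≤ 1 / 3) :
    ∫⁻ x, ENNReal.ofReal (Real.exp (c / 2 * x ^ 2)) ∂(gaussianReal 0 1)
      ≤ ENNReal.ofReal (Real.exp ((c + c ^ 2) / 2)) := by
  have h1 := abs_le.1 hc
  rw [gaussianReal_of_var_ne_zero _ one_ne_zero,
    lintegral_withDensity_eq_lintegral_mul _ (by fun_prop) (by fun_prop)]
  have : ∀ x, (gaussianPDF 0 1 * fun x => ENNReal.ofReal (Real.exp (c / 2 * x ^ 2))) x
      = ENNReal.ofReal ((√(2 * Real.pi))⁻¹ * Real.exp (-((1 - c) / 2) * x ^ 2)) := by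
    intro x
    rw [Pi.mul_apply, gaussianPDF, ← ENNReal.ofReal_mul (gaussianPDFReal_nonneg _ _ _),
      gaussianPDFReal]
    congr 1
    simp only [NNReal.coe_one, mul_one, sub_zero]
    rw [mul_assoc, ← Real.exp_add]
    congr 2; ring
  simp_rw [this]
  rw [← ofReal_integral_eq_lintegral_ofReal]
  · apply ENNReal.ofReal_le_ofReal
    rw [integral_const_mul, integral_gaussian, ← Real.sqrt_inv, ← Real.sqrt_mul (by positivity)]
    convert one_sub_inv_sqrt_le c hc using 2
    have : 1 - c ≠ 0 := by linarith
    field_simp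
  · exact (integrable_exp_neg_mul_sq (by linarith)).const_mul _
  · exact ae_of_all _ fun x => by positivity

lemma gauss_quad {ι : Type*} [Fintype ι] [DecidableEq ι] {n : ℕ} (hn : n ≤ Fintype.card ι)
    (M : Matrix (Fin n) ι ℝ) (hM : M * Mᵀ = 1) (t u : ℝ) (h1 : |u * t| ≤ 1 / 3)
    (h2 : |u * (1 - t)| ≤ 1 / 3) :
    ∫⁻ g : EuclideanSpace ℝ ι, ENNReal.ofReal (Real.exp (u / 2 * phiDev t M g.ofLp))
        ∂(stdGaussian (EuclideanSpace ℝ ι))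
      ≤ ENNReal.ofReal (Real.exp ((u * (n - Fintype.card ι * t) +
        u ^ 2 * (n * (1 - t) ^ 2 + (Fintype.card ι - n) * t ^ 2)) / 2)) := by
  classical
  set N := Fintype.card ι with hN
  let v : Fin n ⊕ Fin (N - n) → EuclideanSpace ℝ ι := Sum.elim (fun i => WithLp.toLp 2 (fun j => M i j)) 0
  have hv : Orthonormal ℝ ((Set.range Sum.inl).domRestrict v) := by
    rw [orthonormal_iff_ite]
    rintro ⟨_, i, rfl⟩ ⟨_, j, rfl⟩
    have : (M * Mᵀ) j i = (1 : Matrix (Fin n) (Fin n) ℝ) j i := by rw [hM]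
    simp only [Matrix.mul_apply, Matrix.transpose_apply, Matrix.one_apply] at this
    have e : inner ℝ (WithLp.toLp 2 (fun k => M i k) : EuclideanSpace ℝ ι)
        (WithLp.toLp 2 (fun k => M j k)) = if j = i then (1 : ℝ) else 0 := by
      rw [← this]
      simp [PiLp.inner_apply]
    refine Eq.trans e ?_
    by_cases hij : i = j
    · subst hij; simp
    · have hij2 : j ≠ i := fun h => hij h.symm
      simp only [hij2, if_false]
      rw [if_neg]
      intro h
      exact hij (Sum.inl_injective (congrArg Subtype.val h))
  obtain ⟨b, hb⟩ := hv.exists_orthonormalBasis_extension_of_card_eq (by simp [← hN]; omega)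
  have hφ : ∀ x : Fin n ⊕ Fin (N - n) → ℝ, phiDev t M (∑ i, x i • b i).ofLp
      = ∑ i, (Sum.elim (fun _ => 1 - t) (fun _ => -t) i : ℝ) * x i ^ 2 := by
    intro x
    have e1 : ((∑ i, x i • b i).ofLp) ⬝ᵥ ((∑ i, x i • b i).ofLp) = ∑ i, x i ^ 2 := by
      have : ‖∑ i, x i • b i‖ ^ 2 = ∑ i, x i ^ 2 := by
        rw [← real_inner_self_eq_norm_sq, b.orthonormal.inner_sum]
        simp [sq]
      rw [← this, EuclideanSpace.real_norm_sq_eq]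
      simp [dotProduct, sq]
    have e2 : ∀ k, (M *ᵥ (∑ i, x i • b i).ofLp) k = x (Sum.inl k) := by
      intro k
      have : inner ℝ (b (Sum.inl k)) (∑ i, x i • b i) = x (Sum.inl k) :=
        b.orthonormal.inner_right_fintype x _
      rw [← this, hb _ ⟨k, rfl⟩]
      simp [v, PiLp.inner_apply, Matrix.mulVec, dotProduct, mul_comm]
    rw [phiDev, e1]
    simp only [dotProduct, e2]
    simp only [Fintype.sum_sum_type, Sum.elim_inl, Sum.elim_inr, ← Finset.mul_sum]
    simp only [← sq]
    ring
  rw [stdGaussian_eq_map_pi_orthonormalBasis b, lintegral_map _ (by fun_prop)]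
  · simp_rw [hφ, Finset.mul_sum, Real.exp_sum]
    simp_rw [ENNReal.ofReal_prod_of_nonneg (fun i _ => (Real.exp_pos _).le)]
    set c : Fin n ⊕ Fin (N - n) → ℝ := fun i => u * Sum.elim (fun _ => 1 - t) (fun _ => -t) i with hcdef
    have hind := iIndepFun_pi (μ := fun _ : Fin n ⊕ Fin (N - n) => gaussianReal 0 1)
      (X := fun i x => ENNReal.ofReal (Real.exp (c i / 2 * x ^ 2))) (fun i => by fun_prop)
    have := lintegral_prod_eq_prod_lintegral_of_indepFun Finset.univ _ hind (fun i => by fun_prop)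
    have hc : ∀ i, |c i| ≤ 1 / 3 := by
      rintro (i | i)
      · simpa [c] using h2
      · simpa [c] using h1
    calc _ = _ := by
          refine Eq.trans ?_ this
          refine lintegral_congr fun x => Finset.prod_congr rfl fun i _ => ?_
          congr 2; simp only [c]; ring
      _ = ∏ i, ∫⁻ x, ENNReal.ofReal (Real.exp (c i / 2 * x ^ 2)) ∂(gaussianReal 0 1) := by
          refine Finset.prod_congr rfl fun i _ => ?_
          exact (measurePreserving_eval (fun _ : Fin n ⊕ Fin (N - n) => gaussianReal 0 1)
            i).lintegral_comp (f := fun x => ENNReal.ofReal (Real.exp (c i / 2 * x ^ 2)))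
              (by fun_prop)
      _ ≤ ∏ i, ENNReal.ofReal (Real.exp ((c i + c i ^ 2) / 2)) :=
          Finset.prod_le_prod' fun i _ => gauss_one _ (hc i)
      _ = _ := by
          rw [← ENNReal.ofReal_prod_of_nonneg (fun i _ => (Real.exp_pos _).le), ← Real.exp_sum]
          congr 2
          simp [c, Fintype.sum_sum_type, Nat.cast_sub hn]
          ring
  · unfold phiDev dotProduct Matrix.mulVec dotProduct
    fun_prop

lemma phiDev_measurable {ι : Type*} [Fintype ι] {n : ℕ} (t : ℝ) :
    Measurable (fun z : Matrix (Fin n) ι ℝ × (ι → ℝ) => phiDev t z.1 z.2) := by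
  have h : ∀ i j, Measurable (fun z : Matrix (Fin n) ι ℝ × (ι → ℝ) => z.1 i j) := fun i j =>
    (measurable_pi_apply j).comp ((measurable_pi_apply i).comp measurable_fst)
  unfold phiDev dotProduct Matrix.mulVec dotProduct
  fun_prop

lemma phiDev_smul {ι : Type*} [Fintype ι] {n : ℕ} (t r : ℝ) (M : Matrix (Fin n) ι ℝ)
    (x : ι → ℝ) : phiDev t M (r • x) = r ^ 2 * phiDev t M x := by
  simp [phiDev, Matrix.mulVec_smul]; ring

lemma exists_orth_s9 {ι : Type*} [Fintype ι] [DecidableEq ι] (x y : EuclideanSpace ℝ ι)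
    (h : ‖x‖ = ‖y‖) : ∃ O : Matrix ι ι ℝ, O * Oᵀ = 1 ∧ O *ᵥ x.ofLp = y.ofLp := by
  let f := Submodule.reflection (ℝ ∙ (x - y))ᗮ
  let b := EuclideanSpace.basisFun ι ℝ
  refine ⟨f.toMatrix b.toBasis b.toBasis, ?_, ?_⟩
  · have := f.toMatrix_mem_unitaryGroup b b
    rw [Matrix.mem_unitaryGroup_iff] at this
    simpa [Matrix.star_eq_conjTranspose] using this
  · have h1 : f x = y := Submodule.reflection_sub h
    have := LinearMap.toMatrix_mulVec_repr b.toBasis b.toBasis f.toLinearMap x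
    have e : ∀ z : EuclideanSpace ℝ ι, (b.toBasis.repr z : ι → ℝ) = z.ofLp := by
      intro z; ext i; simp [b]
    rw [e, e] at this
    rw [← h1]; exact this

lemma phiDev_joint {Ω ι : Type*} [MeasurableSpace Ω] [Fintype ι] {n : ℕ}
    (V : Ω → Matrix (Fin n) ι ℝ) (hVm : Measurable V) (t u : ℝ) :
    Measurable (Function.uncurry fun (g : EuclideanSpace ℝ ι) (ω : Ω) =>
      ENNReal.ofReal (Real.exp (u / 2 * phiDev t (V ω) g.ofLp))) := by
  have h1 : Measurable (fun z : EuclideanSpace ℝ ι × Ω => z.1.ofLp) := by fun_prop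
  have h2 : Measurable (fun z : EuclideanSpace ℝ ι × Ω => V z.2) := hVm.comp measurable_snd
  have h3 := (phiDev_measurable (ι := ι) (n := n) t).comp (h2.prodMk h1)
  simp only [Function.comp_def] at h3
  unfold Function.uncurry
  fun_prop

lemma phiDev_key {Ω ι : Type*} [MeasurableSpace Ω] (P : Measure Ω) [IsProbabilityMeasure P]
    [Fintype ι] [DecidableEq ι] {n : ℕ}
    (V : Ω → Matrix (Fin n) ι ℝ) (hVm : Measurable V)
    (hVO : ∀ O : Matrix ι ι ℝ, O * Oᵀ = 1 →
      Measure.map (fun ω => V ω * O) P = Measure.map V P) (t u : ℝ)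
    (x : EuclideanSpace ℝ ι) (hx : ‖x‖ = 1) (g : EuclideanSpace ℝ ι) :
    P {ω | 0 ≤ u * phiDev t (V ω) x.ofLp} ≤
      ∫⁻ ω, ENNReal.ofReal (Real.exp (u / 2 * phiDev t (V ω) g.ofLp)) ∂P := by
  by_cases hg : g = 0
  · subst hg
    simp [phiDev, prob_le_one]
  have hgn : 0 < ‖g‖ := norm_pos_iff.2 hg
  obtain ⟨O, hO, hOg⟩ := exists_orth_s9 g (‖g‖ • x) (by simp [norm_smul, hx])
  have hS : MeasurableSet {M : Matrix (Fin n) ι ℝ | 0 ≤ u * phiDev t M g.ofLp} := by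
    apply measurableSet_le measurable_const
    exact ((phiDev_measurable t).comp (measurable_id.prodMk measurable_const)).const_mul u
  have hVOm : Measurable fun ω => V ω * O := by
    have hij : ∀ i j, Measurable fun ω => V ω i j := fun i j =>
      (measurable_pi_apply j).comp ((measurable_pi_apply i).comp hVm)
    refine measurable_pi_iff.2 fun i => measurable_pi_iff.2 fun j => ?_
    simp only [Matrix.mul_apply]
    fun_prop
  have e1 := congrArg (fun μ => μ {M : Matrix (Fin n) ι ℝ | 0 ≤ u * phiDev t M g.ofLp}) (hVO O hO)
  simp only at e1
  rw [Measure.map_apply hVOm hS, Measure.map_apply hVm hS] at e1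
  have hOO : Oᵀ * O = 1 := mul_eq_one_comm.1 hO
  have hnorm : (O *ᵥ g.ofLp) ⬝ᵥ (O *ᵥ g.ofLp) = g.ofLp ⬝ᵥ g.ofLp := by
    rw [Matrix.dotProduct_mulVec, ← Matrix.mulVec_transpose, Matrix.mulVec_mulVec, hOO,
      Matrix.one_mulVec]
  have e2 : ∀ ω, phiDev t (V ω * O) g.ofLp = ‖g‖ ^ 2 * phiDev t (V ω) x.ofLp := by
    intro ω
    rw [← phiDev_smul]
    have : (‖g‖ • x).ofLp = ‖g‖ • x.ofLp := rfl
    rw [← this, ← hOg, phiDev, phiDev, hnorm, Matrix.mulVec_mulVec]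
  have e3 : {ω | 0 ≤ u * phiDev t (V ω) x.ofLp}
      = (fun ω => V ω * O) ⁻¹' {M | 0 ≤ u * phiDev t M g.ofLp} := by
    ext ω
    simp only [Set.mem_ofPred_eq, Set.mem_preimage, e2]
    rw [show u * (‖g‖ ^ 2 * phiDev t (V ω) x.ofLp) = ‖g‖ ^ 2 * (u * phiDev t (V ω) x.ofLp) by ring]
    exact (mul_nonneg_iff_of_pos_left (by positivity)).symm
  rw [e3, e1, ← lintegral_indicator_one (hVm hS)]
  refine lintegral_mono fun ω => ?_
  by_cases hω : ω ∈ V ⁻¹' {M | 0 ≤ u * phiDev t M g.ofLp}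
  · rw [Set.indicator_of_mem hω]
    simp only [Pi.one_apply]
    rw [← ENNReal.ofReal_one]
    apply ENNReal.ofReal_le_ofReal
    apply Real.one_le_exp
    have : 0 ≤ u * phiDev t (V ω) g.ofLp := hω
    linarith
  · rw [Set.indicator_of_notMem hω]; exact zero_le

lemma phiDev_tail {Ω ι : Type*} [MeasurableSpace Ω] (P : Measure Ω) [IsProbabilityMeasure P]
    [Fintype ι] [DecidableEq ι] {n : ℕ} (hn : n ≤ Fintype.card ι)
    (V : Ω → Matrix (Fin n) ι ℝ) (hV : IsUniformStiefel P V) (t u : ℝ) (h1 : |u * t| ≤ 1 / 3)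
    (h2 : |u * (1 - t)| ≤ 1 / 3) (x : EuclideanSpace ℝ ι) (hx : ‖x‖ = 1) :
    P {ω | 0 ≤ u * phiDev t (V ω) x.ofLp}
      ≤ ENNReal.ofReal (Real.exp ((u * (n - Fintype.card ι * t) +
        u ^ 2 * (n * (1 - t) ^ 2 + (Fintype.card ι - n) * t ^ 2)) / 2)) := by
  obtain ⟨hVm, hV1, hVO⟩ := hV
  calc P {ω | 0 ≤ u * phiDev t (V ω) x.ofLp}
      = ∫⁻ g : EuclideanSpace ℝ ι, P {ω | 0 ≤ u * phiDev t (V ω) x.ofLp}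
          ∂(stdGaussian (EuclideanSpace ℝ ι)) := by simp
    _ ≤ ∫⁻ g : EuclideanSpace ℝ ι, ∫⁻ ω, ENNReal.ofReal (Real.exp (u / 2 * phiDev t (V ω) g.ofLp)) ∂P
          ∂(stdGaussian (EuclideanSpace ℝ ι)) := lintegral_mono (phiDev_key P V hVm hVO t u x hx)
    _ = ∫⁻ ω, ∫⁻ g : EuclideanSpace ℝ ι, ENNReal.ofReal (Real.exp (u / 2 * phiDev t (V ω) g.ofLp))
          ∂(stdGaussian (EuclideanSpace ℝ ι)) ∂P := by
        exact lintegral_lintegral_swap (phiDev_joint V hVm t u).aemeasurable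
    _ ≤ ∫⁻ ω, ENNReal.ofReal (Real.exp ((u * (n - Fintype.card ι * t) +
        u ^ 2 * (n * (1 - t) ^ 2 + (Fintype.card ι - n) * t ^ 2)) / 2)) ∂P := by
        refine lintegral_mono_ae (hV1.mono fun ω hω => ?_)
        exact gauss_quad hn _ hω t u h1 h2
    _ = _ := by simp

/-- Two-sided tail for a fixed unit vector. -/
lemma unit_tail {Ω ι : Type*} [MeasurableSpace Ω] (P : Measure Ω) [IsProbabilityMeasure P]
    [Fintype ι] [DecidableEq ι] {n : ℕ} (hn0 : 0 < n) (hn : n ≤ Fintype.card ι)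
    (V : Ω → Matrix (Fin n) ι ℝ) (hV : IsUniformStiefel P V) (δ : ℝ) (hδ0 : 0 < δ)
    (hδ : δ ≤ 1 / 3) (x : EuclideanSpace ℝ ι) (hx : ‖x‖ = 1) :
    P {ω | δ ≤ |(Fintype.card ι / n : ℝ) * ((V ω *ᵥ x.ofLp) ⬝ᵥ (V ω *ᵥ x.ofLp)) - 1|}
      ≤ ENNReal.ofReal (2 * Real.exp (-(n * δ ^ 2 / 8))) := by
  set N := Fintype.card ι with hN
  have hn0' : (0 : ℝ) < n := by exact_mod_cast hn0
  have hnN : (n : ℝ) ≤ N := by exact_mod_cast hn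
  have hN0 : (0 : ℝ) < N := by linarith
  set r : ℝ := n / N with hr
  have hr0 : 0 < r := by positivity
  have hr1 : r ≤ 1 := by rw [hr, div_le_one hN0]; exact hnN
  have hNr : N * r = n := by rw [hr]; field_simp
  have hxx : x.ofLp ⬝ᵥ x.ofLp = 1 := by
    have := EuclideanSpace.real_norm_sq_eq x
    rw [hx] at this
    simp only [dotProduct, ← sq]; linarith
  have hcomm : ∀ σ : ℝ, |σ| = 1 →
      P {ω | 0 ≤ (σ * (δ / 2)) * phiDev ((1 + σ * δ) * r) (V ω) x.ofLp}
        ≤ ENNReal.ofReal (Real.exp (-(n * δ ^ 2 / 8))) := by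
    intro σ hσ
    have hσ2 : σ ^ 2 = 1 := by rw [← sq_abs, hσ]; norm_num
    have hσl := abs_le.1 hσ.le
    have hs1 : -δ ≤ σ * δ ∧ σ * δ ≤ δ := ⟨by nlinarith, by nlinarith⟩
    have ht0 : 0 ≤ (1 + σ * δ) * r := mul_nonneg (by linarith) hr0.le
    have ht1 : (1 + σ * δ) * r ≤ 4 / 3 := by nlinarith
    refine (phiDev_tail P hn V hV _ _ ?_ ?_ x hx).trans ?_
    · rw [abs_mul, abs_mul, hσ, abs_of_pos (by positivity : 0 < δ / 2), abs_of_nonneg ht0]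
      nlinarith
    · rw [abs_mul, abs_mul, hσ, abs_of_pos (by positivity : 0 < δ / 2)]
      have : |1 - (1 + σ * δ) * r| ≤ 1 := abs_le.2 ⟨by linarith, by linarith⟩
      nlinarith [abs_nonneg (1 - (1 + σ * δ) * r)]
    · apply ENNReal.ofReal_le_ofReal
      apply Real.exp_le_exp.2
      have e : σ * (δ / 2) * (n - N * ((1 + σ * δ) * r)) + (σ * (δ / 2)) ^ 2 *
          (n * (1 - (1 + σ * δ) * r) ^ 2 + (N - n) * ((1 + σ * δ) * r) ^ 2)
          = - (n * δ ^ 2 / 2) + δ ^ 2 / 4 * (n * (1 - (1 - σ * δ) * ((1 + σ * δ) * r))) := by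
        rw [← hNr]
        linear_combination (-(N * r * δ ^ 2 / 2) + δ ^ 2 / 4 * (N * r * (1 - (1 + σ * δ) * r) ^ 2 + (N - N * r) * ((1 + σ * δ) * r) ^ 2)) * hσ2
      rw [e]
      have h3 : n * (1 - (1 - σ * δ) * ((1 + σ * δ) * r)) ≤ n := by
        have : 0 ≤ (1 - σ * δ) * ((1 + σ * δ) * r) := mul_nonneg (by linarith) ht0
        nlinarith
      nlinarith [sq_nonneg δ]
  have hsub : {ω | δ ≤ |(N / n : ℝ) * ((V ω *ᵥ x.ofLp) ⬝ᵥ (V ω *ᵥ x.ofLp)) - 1|} ⊆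
      {ω | 0 ≤ (1 * (δ / 2)) * phiDev ((1 + 1 * δ) * r) (V ω) x.ofLp} ∪
      {ω | 0 ≤ (-1 * (δ / 2)) * phiDev ((1 + -1 * δ) * r) (V ω) x.ofLp} := by
    intro ω hω
    simp only [Set.mem_ofPred_eq, Set.mem_union] at hω ⊢
    set w := (V ω *ᵥ x.ofLp) ⬝ᵥ (V ω *ᵥ x.ofLp) with hw
    have hw' : w = r * ((N / n : ℝ) * w) := by rw [hr]; field_simp
    simp only [phiDev, hxx, ← hw]
    rcases le_abs.1 hω with h | h
    · left
      have : 0 ≤ w - (1 + 1 * δ) * r * 1 := by rw [hw']; nlinarith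
      positivity
    · right
      have : 0 ≤ -(w - (1 + -1 * δ) * r * 1) := by rw [hw']; nlinarith
      nlinarith
  refine (measure_mono hsub).trans ((measure_union_le _ _).trans ?_)
  refine (add_le_add (hcomm 1 (by simp)) (hcomm (-1) (by simp))).trans ?_
  rw [← ENNReal.ofReal_add (by positivity) (by positivity), two_mul]

open Metric Module in
lemma card_le_of_sep {F : Type*} [NormedAddCommGroup F] [NormedSpace ℝ F] [FiniteDimensional ℝ F]
    (s : Finset F) (hs : ∀ c ∈ s, ‖c‖ = 1)
    (h : ∀ c ∈ s, ∀ d ∈ s, c ≠ d → 1 / 4 ≤ ‖c - d‖) : s.card ≤ 9 ^ finrank ℝ F := by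
  borelize F
  let μ : Measure F := Measure.addHaar
  let δ : ℝ := (1 : ℝ) / 8
  let ρ : ℝ := (9 : ℝ) / 8
  have ρpos : 0 < ρ := by norm_num [ρ]
  set A := ⋃ c ∈ s, ball (c : F) δ with hA
  have D : Set.Pairwise (s : Set F) (Function.onFun Disjoint fun c => ball (c : F) δ) := by
    rintro c hc d hd hcd
    apply ball_disjoint_ball
    rw [dist_eq_norm]
    have := h c hc d hd hcd
    simp only [δ]; linarith
  have A_subset : A ⊆ ball (0 : F) ρ := by
    refine Set.iUnion₂_subset fun x hx => ?_
    apply ball_subset_ball'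
    rw [dist_zero_right, hs x hx]
    norm_num [δ, ρ]
  have I :
    (s.card : ℝ≥0∞) * ENNReal.ofReal (δ ^ finrank ℝ F) * μ (ball 0 1) ≤
      ENNReal.ofReal (ρ ^ finrank ℝ F) * μ (ball 0 1) :=
    calc
      (s.card : ℝ≥0∞) * ENNReal.ofReal (δ ^ finrank ℝ F) * μ (ball 0 1) = μ A := by
        rw [hA, measure_biUnion_finset D fun c _ => measurableSet_ball]
        have I : 0 < δ := by norm_num [δ]
        simp only [μ.addHaar_ball_of_pos _ I]
        simp only [Finset.sum_const, nsmul_eq_mul, mul_assoc]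
      _ ≤ μ (ball (0 : F) ρ) := measure_mono A_subset
      _ = ENNReal.ofReal (ρ ^ finrank ℝ F) * μ (ball 0 1) := by
        simp only [μ.addHaar_ball_of_pos _ ρpos]
  have J : (s.card : ℝ≥0∞) * ENNReal.ofReal (δ ^ finrank ℝ F) ≤ ENNReal.ofReal (ρ ^ finrank ℝ F) :=
    (ENNReal.mul_le_mul_iff_left (measure_ball_pos _ _ zero_lt_one).ne' measure_ball_lt_top.ne).1 I
  have K : (s.card : ℝ) ≤ (9 : ℝ) ^ finrank ℝ F := by
    have := ENNReal.toReal_le_of_le_ofReal (pow_nonneg ρpos.le _) J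
    simpa [ρ, δ, div_eq_mul_inv, mul_pow] using this
  exact mod_cast K

lemma exists_net (F : Type*) [NormedAddCommGroup F] [NormedSpace ℝ F] [FiniteDimensional ℝ F] :
    ∃ T : Finset F, T.card ≤ 9 ^ Module.finrank ℝ F ∧ (∀ x ∈ T, ‖x‖ = 1) ∧
      ∀ x : F, ‖x‖ = 1 → ∃ y ∈ T, ‖x - y‖ ≤ 1 / 4 := by
  classical
  by_contra! H
  have step : ∀ k : ℕ, ∃ T : Finset F, T.card = k ∧ (∀ x ∈ T, ‖x‖ = 1) ∧
      (∀ c ∈ T, ∀ d ∈ T, c ≠ d → 1 / 4 ≤ ‖c - d‖) := by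
    intro k
    induction k with
    | zero => exact ⟨∅, by simp, by simp, by simp⟩
    | succ k ih =>
      obtain ⟨T, hTk, hT1, hT2⟩ := ih
      obtain ⟨x, hx1, hx⟩ := H T (card_le_of_sep T hT1 hT2) hT1
      have hxT : x ∉ T := fun h => by
        have := hx x h
        norm_num at this
      refine ⟨insert x T, by rw [Finset.card_insert_of_notMem hxT, hTk], ?_, ?_⟩
      · intro y hy
        rcases Finset.mem_insert.1 hy with rfl | hy
        · exact hx1
        · exact hT1 y hy
      · intro c hc d hd hcd
        rcases Finset.mem_insert.1 hc with rfl | hc2 <;> rcases Finset.mem_insert.1 hd with rfl | hd2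
        · exact absurd rfl hcd
        · exact (hx d hd2).le
        · rw [norm_sub_rev]; exact (hx c hc2).le
        · exact hT2 c hc2 d hd2 hcd
  obtain ⟨T, h1, h2, h3⟩ := step (9 ^ Module.finrank ℝ F + 1)
  have := card_le_of_sep T h2 h3
  omega

lemma net_bilin {F G : Type*} [NormedAddCommGroup F] [InnerProductSpace ℝ F]
    [FiniteDimensional ℝ F] [NormedAddCommGroup G] [InnerProductSpace ℝ G] [FiniteDimensional ℝ G]
    (B : F →L[ℝ] G) (c η : ℝ) (T : Finset F)
    (hT : ∀ x : F, ‖x‖ = 1 → ∃ y ∈ T, ‖x - y‖ ≤ 1 / 4) (hT1 : ∀ x ∈ T, ‖x‖ = 1)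
    (hη : 0 ≤ η) (h : ∀ y ∈ T, |c * inner ℝ (B y) (B y) - 1| ≤ η) (x y : F) :
    c * inner ℝ (B x) (B y) - inner ℝ x y ≤ 2 * η * ‖x‖ * ‖y‖ := by
  have := FiniteDimensional.complete ℝ F
  have := FiniteDimensional.complete ℝ G
  let S : F →L[ℝ] F := c • ((ContinuousLinearMap.adjoint B).comp B) - ContinuousLinearMap.id ℝ F
  have hS : ∀ x y, inner ℝ (S x) y = c * inner ℝ (B x) (B y) - inner ℝ x y := by
    intro x y
    simp [S, inner_sub_left, inner_smul_left, ContinuousLinearMap.adjoint_inner_left]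
  have hsym : ∀ x y, inner ℝ (S x) y = inner ℝ (S y) x := by
    intro x y
    rw [hS, hS, real_inner_comm (B x), real_inner_comm x]
  set κ := η + ‖S‖ / 2 with hκ
  have hκ0 : 0 ≤ κ := by positivity
  have u1 : ∀ z : F, ‖z‖ = 1 → |inner ℝ (S z) z| ≤ κ := by
    intro z hz
    obtain ⟨w, hw, hzw⟩ := hT z hz
    have e : inner ℝ (S z) z = inner ℝ (S w) w + inner ℝ (S (z - w)) (z + w) := by
      simp only [map_sub, inner_sub_left, inner_add_right]
      rw [hsym w z]; ring
    have e2 : |inner ℝ (S w) w| ≤ η := by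
      rw [hS, real_inner_self_eq_norm_sq w, hT1 w hw]
      simpa using h w hw
    have e3 : |inner ℝ (S (z - w)) (z + w)| ≤ ‖S‖ / 2 := by
      have a1 := abs_real_inner_le_norm (S (z - w)) (z + w)
      have a2 := S.le_opNorm (z - w)
      have a3 : ‖z + w‖ ≤ 2 := (norm_add_le _ _).trans (by rw [hz, hT1 w hw]; norm_num)
      have a4 : ‖S (z - w)‖ ≤ ‖S‖ * (1 / 4) := a2.trans (by gcongr)
      calc _ ≤ _ := a1
        _ ≤ ‖S‖ * (1 / 4) * 2 := by gcongr
        _ = _ := by ring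
    rw [e]
    exact (abs_add_le _ _).trans (add_le_add e2 e3)
  have u2 : ∀ z : F, |inner ℝ (S z) z| ≤ κ * ‖z‖ ^ 2 := by
    intro z
    by_cases hz : z = 0
    · simp [hz]
    have hz0 : 0 < ‖z‖ := norm_pos_iff.2 hz
    have := u1 (‖z‖⁻¹ • z) (by rw [norm_smul, norm_inv, norm_norm, inv_mul_cancel₀ hz0.ne'])
    rw [map_smul, inner_smul_left, inner_smul_right, abs_mul, abs_mul] at this
    simp only [conj_trivial, abs_inv, abs_norm] at this
    have h2 : ‖z‖⁻¹ * (‖z‖⁻¹ * |inner ℝ (S z) z|) * ‖z‖ ^ 2 = |inner ℝ (S z) z| := by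
      field_simp
    rw [← h2]
    gcongr
  have u3 : ∀ x y : F, 4 * inner ℝ (S x) y ≤ 2 * κ * (‖x‖ ^ 2 + ‖y‖ ^ 2) := by
    intro x y
    have e : 4 * inner ℝ (S x) y = inner ℝ (S (x + y)) (x + y) - inner ℝ (S (x - y)) (x - y) := by
      simp only [map_add, map_sub, inner_add_left, inner_sub_left, inner_add_right, inner_sub_right]
      rw [hsym y x]; ring
    have p := parallelogram_law_with_norm ℝ x y
    have a1 := (abs_le.1 (u2 (x + y))).2
    have a2 := (abs_le.1 (u2 (x - y))).1
    rw [e]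
    nlinarith
  have u4 : ‖S‖ ≤ κ := by
    refine S.opNorm_le_bound hκ0 fun z => ?_
    by_cases hz : S z = 0
    · rw [hz, norm_zero]; positivity
    have hz0 : 0 < ‖S z‖ := norm_pos_iff.2 hz
    have hz1 : 0 < ‖z‖ := norm_pos_iff.2 (fun h => hz (by rw [h, map_zero]))
    have := u3 z ((‖z‖ / ‖S z‖) • S z)
    rw [inner_smul_right, real_inner_self_eq_norm_sq, norm_smul, Real.norm_of_nonneg (by positivity),
      div_mul_cancel₀ _ hz0.ne'] at this
    have e : ‖z‖ / ‖S z‖ * ‖S z‖ ^ 2 = ‖z‖ * ‖S z‖ := by field_simp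
    rw [e] at this
    nlinarith
  have u5 : ‖S‖ ≤ 2 * η := by linarith
  rw [← hS]
  calc _ ≤ ‖S x‖ * ‖y‖ := real_inner_le_norm _ _
    _ ≤ ‖S‖ * ‖x‖ * ‖y‖ := by gcongr; exact S.le_opNorm x
    _ ≤ _ := by gcongr

lemma sum_mul_extend {κ κ' : Type*} [Fintype κ] [Fintype κ'] (e : κ → κ')
    (he : Function.Injective e) (f : κ' → ℝ) (z : κ → ℝ) :
    f ⬝ᵥ (Function.extend e z 0) = (fun i => f (e i)) ⬝ᵥ z := by
  symm
  apply Fintype.sum_of_injective e he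
  · intro i hi
    rw [Function.extend_apply' _ _ _ (fun ⟨a, ha⟩ => hi ⟨a, ha⟩)]; simp
  · intro i; rw [he.extend_apply]

lemma mulVec_extend {n : ℕ} {κ κ' : Type*} [Fintype κ] [Fintype κ'] (e : κ → κ')
    (he : Function.Injective e) (M : Matrix (Fin n) κ' ℝ) (z : κ → ℝ) :
    M *ᵥ (Function.extend e z 0) = (M.submatrix id e) *ᵥ z := by
  ext i
  exact sum_mul_extend e he _ z

lemma norm_extend {κ κ' : Type*} [Fintype κ] [Fintype κ'] (e : κ → κ')
    (he : Function.Injective e) (z : EuclideanSpace ℝ κ) :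
    ‖(WithLp.toLp 2 (Function.extend e z.ofLp 0) : EuclideanSpace ℝ κ')‖ = ‖z‖ := by
  rw [EuclideanSpace.norm_eq, EuclideanSpace.norm_eq]
  congr 1
  symm
  apply Fintype.sum_of_injective e he
  · intro i hi
    simp [Function.extend_apply' _ _ _ (fun ⟨a, ha⟩ => hi ⟨a, ha⟩)]
  · intro i; simp [he.extend_apply]

lemma specNorm_le {n : ℕ} {κ κ' : Type*} [Fintype κ] [Fintype κ'] [DecidableEq κ']
    (X : Matrix (Fin n) κ ℝ) (Y : Matrix (Fin n) κ' ℝ) (c C : ℝ) (hC : 0 ≤ C)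
    (h : ∀ (x : EuclideanSpace ℝ κ) (y : EuclideanSpace ℝ κ'),
      c * ((X *ᵥ x.ofLp) ⬝ᵥ (Y *ᵥ y.ofLp)) ≤ C * ‖x‖ * ‖y‖) :
    specNorm (c • (Xᵀ * Y)) ≤ C := by
  refine ContinuousLinearMap.opNorm_le_bound _ hC fun y => ?_
  set w : EuclideanSpace ℝ κ := LinearMap.toContinuousLinearMap (Matrix.toEuclideanLin (c • (Xᵀ * Y))) y
    with hw
  have e : ‖w‖ ^ 2 = c * ((X *ᵥ w.ofLp) ⬝ᵥ (Y *ᵥ y.ofLp)) := by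
    have e1 : w.ofLp = c • (Xᵀ *ᵥ (Y *ᵥ y.ofLp)) := by
      rw [hw]
      simp [Matrix.toLpLin_apply, Matrix.mulVec_mulVec]
    have e2 : ‖w‖ ^ 2 = w.ofLp ⬝ᵥ w.ofLp := by
      rw [EuclideanSpace.real_norm_sq_eq]; simp [dotProduct, sq]
    rw [e2]
    nth_rewrite 2 [e1]
    rw [dotProduct_smul, Matrix.dotProduct_mulVec, Matrix.vecMul_transpose, smul_eq_mul]
  have h1 := h w y
  rw [← e] at h1
  by_cases hw0 : ‖w‖ = 0
  · rw [hw0]; positivity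
  · have : 0 < ‖w‖ := lt_of_le_of_ne (norm_nonneg _) (Ne.symm hw0)
    nlinarith

lemma det_bound {n : ℕ} {κ α β : Type*} [Fintype κ] [DecidableEq κ] [Fintype α] [Fintype β]
    [DecidableEq β]
    (B : Matrix (Fin n) κ ℝ) (e₁ : α → κ) (e₂ : β → κ) (he₁ : Function.Injective e₁)
    (he₂ : Function.Injective e₂) (hd : ∀ i j, e₁ i ≠ e₂ j) (c η : ℝ) (hη : 0 ≤ η)
    (T : Finset (EuclideanSpace ℝ κ))
    (hT : ∀ x : EuclideanSpace ℝ κ, ‖x‖ = 1 → ∃ y ∈ T, ‖x - y‖ ≤ 1 / 4) (hT1 : ∀ x ∈ T, ‖x‖ = 1)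
    (h : ∀ y ∈ T, |c * ((B *ᵥ y.ofLp) ⬝ᵥ (B *ᵥ y.ofLp)) - 1| ≤ η) :
    specNorm (c • ((B.submatrix id e₁)ᵀ * B.submatrix id e₂)) ≤ 2 * η := by
  apply specNorm_le _ _ _ _ (by positivity)
  intro x y
  have hB : ∀ x y : EuclideanSpace ℝ κ,
      inner ℝ (LinearMap.toContinuousLinearMap (Matrix.toEuclideanLin B) x)
        (LinearMap.toContinuousLinearMap (Matrix.toEuclideanLin B) y)
        = (B *ᵥ x.ofLp) ⬝ᵥ (B *ᵥ y.ofLp) := by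
    intro x y
    simp [PiLp.inner_apply, dotProduct, Matrix.toLpLin_apply, mul_comm]
  have := net_bilin (LinearMap.toContinuousLinearMap (Matrix.toEuclideanLin B)) c η T hT hT1 hη
    (by intro y hy; rw [hB]; exact h y hy) (WithLp.toLp 2 (Function.extend e₁ x.ofLp 0))
    (WithLp.toLp 2 (Function.extend e₂ y.ofLp 0))
  rw [hB, norm_extend e₁ he₁, norm_extend e₂ he₂] at this
  simp only [mulVec_extend _ he₁, mulVec_extend _ he₂] at this
  have h0 : inner ℝ (WithLp.toLp 2 (Function.extend e₁ x.ofLp 0) : EuclideanSpace ℝ κ)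
      (WithLp.toLp 2 (Function.extend e₂ y.ofLp 0)) = 0 := by
    have e : inner ℝ (WithLp.toLp 2 (Function.extend e₁ x.ofLp 0) : EuclideanSpace ℝ κ)
      (WithLp.toLp 2 (Function.extend e₂ y.ofLp 0))
        = (Function.extend e₁ x.ofLp 0) ⬝ᵥ (Function.extend e₂ y.ofLp 0) := by
      simp [PiLp.inner_apply, dotProduct, mul_comm]
    rw [e, sum_mul_extend _ he₂]
    apply Finset.sum_eq_zero
    intro j _
    beta_reduce
    rw [Function.extend_apply' _ _ _ (fun ⟨a, ha⟩ => hd a j ha)]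
    simp
  rw [h0] at this
  linarith

lemma single_block {Ω : Type*} [MeasurableSpace Ω] (P : Measure Ω) [IsProbabilityMeasure P]
    (n p d a s : ℕ) (hs : 1 ≤ s) (hn0 : 0 < n) (hnN : n ≤ p * d)
    (V : Ω → Matrix (Fin n) (Fin p × Fin d) ℝ)
    (hV : IsUniformStiefel P V) (A : Finset (Fin p)) (hA : A.card = a) (k : Fin p) (hk : k ∉ A)
    (hm : ((a + 1) * d : ℕ) ≤ (n : ℝ) / (14400 * s)) :
    P {ω | 1 / (7 * Real.sqrt s)
          ≤ specNorm (((p * d : ℕ) / (n : ℝ)) • ((blockCols (V ω) A)ᵀ * colBlock (V ω) k))}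
      ≤ ENNReal.ofReal (5 * Real.exp (-(n : ℝ) / (28800 * s))) := by
  classical
  have hs0 : (1 : ℝ) ≤ s := by exact_mod_cast hs
  have hsq : 1 ≤ Real.sqrt s := Real.one_le_sqrt.2 hs0
  have hsq2 : Real.sqrt s ^ 2 = s := Real.sq_sqrt (by linarith)
  set J := insert k A with hJ
  set δ : ℝ := 1 / (15 * Real.sqrt s) with hδ
  have hδ0 : 0 < δ := by positivity
  have hδ1 : δ ≤ 1 / 3 := by
    rw [hδ]; apply one_div_le_one_div_of_le (by norm_num); linarith
  obtain ⟨T, hTc, hT1, hT⟩ := exists_net (EuclideanSpace ℝ ({j // j ∈ J} × Fin d))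
  have hfr : Module.finrank ℝ (EuclideanSpace ℝ ({j // j ∈ J} × Fin d)) = (a + 1) * d := by
    rw [finrank_euclideanSpace, Fintype.card_prod, Fintype.card_coe, Fintype.card_fin, hJ,
      Finset.card_insert_of_notMem hk, hA]
  rw [hfr] at hTc
  let e₀ : {j // j ∈ J} × Fin d → Fin p × Fin d := fun z => (z.1.1, z.2)
  have he₀ : Function.Injective e₀ := by
    rintro ⟨⟨i, hi⟩, l⟩ ⟨⟨i', hi'⟩, l'⟩ h
    simp only [e₀, Prod.mk.injEq] at h
    simp [h.1, h.2]
  let e₁ : {j // j ∈ A} × Fin d → {j // j ∈ J} × Fin d :=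
    fun z => (⟨z.1.1, Finset.mem_insert_of_mem z.1.2⟩, z.2)
  have he₁ : Function.Injective e₁ := by
    rintro ⟨⟨i, hi⟩, l⟩ ⟨⟨i', hi'⟩, l'⟩ h
    simp only [e₁, Prod.mk.injEq, Subtype.mk.injEq] at h
    simp [h.1, h.2]
  let e₂ : Fin d → {j // j ∈ J} × Fin d := fun l => (⟨k, Finset.mem_insert_self k A⟩, l)
  have he₂ : Function.Injective e₂ := fun l l' h => (Prod.mk.inj h).2
  have hd : ∀ i j, e₁ i ≠ e₂ j := by
    intro i j h
    have h1 : i.1.1 = k := congrArg Subtype.val (Prod.mk.inj h).1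
    exact hk (h1 ▸ i.1.2)
  have hcard : Fintype.card (Fin p × Fin d) = p * d := by simp
  have hsub : {ω | 1 / (7 * Real.sqrt s)
          ≤ specNorm (((p * d : ℕ) / (n : ℝ)) • ((blockCols (V ω) A)ᵀ * colBlock (V ω) k))} ⊆
      ⋃ z ∈ T, {ω | δ ≤ |(Fintype.card (Fin p × Fin d) / n : ℝ) *
        ((V ω *ᵥ (WithLp.toLp 2 (Function.extend e₀ z.ofLp 0) :
          EuclideanSpace ℝ (Fin p × Fin d)).ofLp) ⬝ᵥ
        (V ω *ᵥ (WithLp.toLp 2 (Function.extend e₀ z.ofLp 0) :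
          EuclideanSpace ℝ (Fin p × Fin d)).ofLp)) - 1|} := by
    intro ω hω
    by_contra hcon
    simp only [Set.mem_iUnion, Set.mem_ofPred_eq, not_exists, not_le, hcard,
      mulVec_extend _ he₀] at hcon
    have hb := det_bound ((V ω).submatrix id e₀) e₁ e₂ he₁ he₂ hd ((p * d : ℕ) / (n : ℝ)) δ hδ0.le
      T hT hT1 (fun y hy => (hcon y hy).le)
    have hω' : 1 / (7 * Real.sqrt s)
          ≤ specNorm (((p * d : ℕ) / (n : ℝ)) • ((((V ω).submatrix id e₀).submatrix id e₁)ᵀ *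
            ((V ω).submatrix id e₀).submatrix id e₂)) := hω
    have h3 := hω'.trans hb
    rw [hδ, ← mul_div_assoc, div_le_div_iff₀ (by positivity) (by positivity)] at h3
    linarith
  refine (measure_mono hsub).trans ((measure_biUnion_finset_le _ _).trans ?_)
  have hbd : ∀ z ∈ T, _ ≤ ENNReal.ofReal (2 * Real.exp (-(n * δ ^ 2 / 8))) := fun z hz =>
    unit_tail P hn0 (by rw [hcard]; exact hnN) V hV δ hδ0 hδ1
      (WithLp.toLp 2 (Function.extend e₀ z.ofLp 0)) ((norm_extend e₀ he₀ z).trans (hT1 z hz))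
  refine (Finset.sum_le_sum hbd).trans ?_
  rw [Finset.sum_const, nsmul_eq_mul, ← ENNReal.ofReal_natCast, ← ENNReal.ofReal_mul (by positivity)]
  apply ENNReal.ofReal_le_ofReal
  have hδ2 : δ ^ 2 = 1 / (225 * s) := by
    rw [hδ, div_pow, mul_pow, hsq2]; norm_num
  have h9 : (9 : ℝ) ≤ Real.exp 3 := by
    have h1 := Real.exp_one_gt_d9
    have h2 : Real.exp 3 = Real.exp 1 ^ 3 := by rw [← Real.exp_nat_mul]; norm_num
    rw [h2]
    calc (9 : ℝ) ≤ 2.5 ^ 3 := by norm_num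
      _ ≤ _ := by gcongr; linarith
  have hT9 : (T.card : ℝ) ≤ Real.exp (3 * (n / (14400 * s))) := by
    calc (T.card : ℝ) ≤ (9 : ℝ) ^ ((a + 1) * d) := by exact_mod_cast hTc
      _ ≤ Real.exp 3 ^ ((a + 1) * d) := by gcongr
      _ = Real.exp (((a + 1) * d : ℕ) * 3) := by rw [← Real.exp_nat_mul]
      _ ≤ _ := by apply Real.exp_le_exp.2; linarith
  calc (T.card : ℝ) * (2 * Real.exp (-(n * δ ^ 2 / 8)))
      ≤ Real.exp (3 * (n / (14400 * s))) * (2 * Real.exp (-(n * δ ^ 2 / 8))) := by gcongr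
    _ = 2 * Real.exp (3 * (n / (14400 * s)) + -(n * δ ^ 2 / 8)) := by rw [Real.exp_add]; ring
    _ ≤ 5 * Real.exp (-(n : ℝ) / (28800 * s)) := by
      have hE : 3 * (n / (14400 * s)) + -(n * δ ^ 2 / 8) ≤ -(n : ℝ) / (28800 * s) := by
        rw [hδ2]
        have e1 : 3 * ((n : ℝ) / (14400 * s)) = (n / s) * (3 / 14400) := by field_simp
        have e2 : (n : ℝ) * (1 / (225 * s)) / 8 = (n / s) * (1 / 1800) := by field_simp; norm_num
        have e3 : -(n : ℝ) / (28800 * s) = -((n / s) * (1 / 28800)) := by field_simp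
        rw [e1, e2, e3]
        have : 0 ≤ (n : ℝ) / s := by positivity
        linarith
      have := Real.exp_le_exp.2 hE
      have := Real.exp_pos (-(n : ℝ) / (28800 * s))
      linarith

/-- **Lemma S.4, specialized.** With `t₈ = 1/(60√s) − √((a+1)d/n)`,
`t₉ = 1/(60√s) − √((a+1)/p)`, `t₁₀ = 1/10 − √((a+1)/p)`:
`P[max_{k∈K} ‖(pd/n)·V_Aᵀ V_k‖ ≥ 1/(7√s)] ≤ 5q exp(−n/(28800 s))`. -/
theorem stiefel_max_cross_gram_concentration_specialized
    {Ω : Type*} [MeasurableSpace Ω] (P : Measure Ω) [IsProbabilityMeasure P]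
    (n p d a q s : ℕ) (hs : 1 ≤ s) (V : Ω → Matrix (Fin n) (Fin p × Fin d) ℝ)
    (hV : IsUniformStiefel P V)
    (A K : Finset (Fin p)) (hA : A.card = a) (hK : K.card = q) (hAK : Disjoint A K)
    (hpad : n ≤ (p - a - 1) * d)
    (h₁ : Real.sqrt (((a + 1) * d : ℕ) / (n : ℝ)) ≤ 1 / (120 * Real.sqrt s))
    (h₂ : Real.sqrt (((a : ℝ) + 1) / p) ≤ 1 / (120 * Real.sqrt s)) :
    P {ω | ∃ k ∈ K,
          1 / (7 * Real.sqrt s)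
          ≤ specNorm (((p * d : ℕ) / (n : ℝ)) • ((blockCols (V ω) A)ᵀ * colBlock (V ω) k))}
      ≤ (q : ℝ≥0∞) * ENNReal.ofReal (5 * Real.exp (-(n : ℝ) / (28800 * s))) := by
  have hs0 : (1 : ℝ) ≤ s := by exact_mod_cast hs
  have hsq : 1 ≤ Real.sqrt s := Real.one_le_sqrt.2 hs0
  have hsq2 : Real.sqrt s ^ 2 = s := Real.sq_sqrt (by linarith)
  rcases Nat.eq_zero_or_pos n with hn | hn0
  · have : {ω | ∃ k ∈ K,
          1 / (7 * Real.sqrt s)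
          ≤ specNorm (((p * d : ℕ) / (n : ℝ)) • ((blockCols (V ω) A)ᵀ * colBlock (V ω) k))} = ∅ := by
      ext ω
      simp only [Set.mem_ofPred_eq, Set.mem_empty_iff_false, iff_false]
      rintro ⟨k, -, h⟩
      have h0 : (((p * d : ℕ) : ℝ) / (n : ℝ)) = 0 := by rw [hn]; simp
      rw [h0, zero_smul] at h
      have : specNorm (0 : Matrix ({j // j ∈ A} × Fin d) (Fin d) ℝ) = 0 := by
        simp [specNorm]
      rw [this] at h
      have : 0 < 1 / (7 * Real.sqrt s) := by positivity
      linarith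
    rw [this]; simp
  · have hnN : n ≤ p * d := hpad.trans (Nat.mul_le_mul_right d (by omega))
    have hn0' : (0 : ℝ) < n := by exact_mod_cast hn0
    have hm : ((a + 1) * d : ℕ) ≤ (n : ℝ) / (14400 * s) := by
      have h3 := (Real.sqrt_le_left (by positivity)).1 h₁
      rw [div_pow, mul_pow, hsq2, div_le_div_iff₀ hn0' (by positivity)] at h3
      rw [le_div_iff₀ (by positivity)]
      linarith
    have hset : {ω | ∃ k ∈ K,
          1 / (7 * Real.sqrt s)
          ≤ specNorm (((p * d : ℕ) / (n : ℝ)) • ((blockCols (V ω) A)ᵀ * colBlock (V ω) k))}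
        = ⋃ k ∈ K, {ω | 1 / (7 * Real.sqrt s)
          ≤ specNorm (((p * d : ℕ) / (n : ℝ)) • ((blockCols (V ω) A)ᵀ * colBlock (V ω) k))} := by
      ext ω; simp
    rw [hset]
    refine (measure_biUnion_finset_le _ _).trans ?_
    refine (Finset.sum_le_sum fun k hk => single_block P n p d a s hs hn0 hnN V hV A hA k
      (fun hkA => Finset.disjoint_left.1 hAK hkA hk) hm).trans ?_
    rw [Finset.sum_const, nsmul_eq_mul, hK]
end
end
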